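/- arXiv:1509.07914 — 10 statements merged into one kernel-verified Lean document; each statement's English description precedes it below -/
import Mathlib

section
/- Let X be an Archimedean vector lattice and let Y be a sublattice of X that is both order dense and majorizing in X. Then for any net (x_α) contained in Y, the net (x_α) order converges to 0 in Y if and only if it order converges to 0 in X. -/
open Filter Finset

universe u v

section Defs

variable {X : Type*} [Lattice X] [AddCommGroup X]

/-- Order convergence of a net `x` to `l`: there is a downward directed set `A` of
dominating elements with infimum `0` (playing the role of a net `(a_γ)` with `a_γ ↓ 0`)
such that for every `a ∈ A`, eventually `|x α - l| ≤ a`. -/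
def OConv {ι : Type*} [Preorder ι] (x : ι → X) (l : X) : Prop :=
  ∃ A : Set X, A.Nonempty ∧ DirectedOn (· ≥ ·) A ∧ IsGLB A 0 ∧
    ∀ a ∈ A, ∃ α₀, ∀ α, α₀ ≤ α → |x α - l| ≤ a

/-- Unbounded order (uo-) convergence: `|x α - l| ⊓ u →o 0` for every `u ≥ 0`. -/
def UoConv {ι : Type*} [Preorder ι] (x : ι → X) (l : X) : Prop :=
  ∀ u : X, 0 ≤ u → OConv (fun α => |x α - l| ⊓ u) (0 : X)

/-- Order Cauchy: the double net `(x α - x β)` order converges to `0`. -/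
def OCauchy {ι : Type*} [Preorder ι] (x : ι → X) : Prop :=
  OConv (fun p : ι × ι => x p.1 - x p.2) (0 : X)

/-- uo-Cauchy: the double net `(x α - x β)` uo-converges to `0`. -/
def UoCauchy {ι : Type*} [Preorder ι] (x : ι → X) : Prop :=
  UoConv (fun p : ι × ι => x p.1 - x p.2) (0 : X)

/-- `l` is the greatest lower bound of `A` relative to the subset `Y`. -/
def IsGLBOn (Y A : Set X) (l : X) : Prop :=
  l ∈ Y ∧ l ∈ lowerBounds A ∧ ∀ y ∈ Y, y ∈ lowerBounds A → y ≤ l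

/-- `l` is the least upper bound of `A` relative to the subset `Y`. -/
def IsLUBOn (Y A : Set X) (l : X) : Prop :=
  l ∈ Y ∧ l ∈ upperBounds A ∧ ∀ y ∈ Y, y ∈ upperBounds A → l ≤ y

/-- `Y` is regular in `X`: infima of subsets of `Y` computed in `Y` are also infima in `X`. -/
def RegularIn (Y : Set X) : Prop :=
  ∀ A : Set X, A ⊆ Y → ∀ l : X, IsGLBOn Y A l → IsGLB A l

/-- Order convergence relative to the sublattice `Y`
(dominating set contained in `Y`, with infimum `0` computed in `Y`). -/
def OConvOn (Y : Set X) {ι : Type*} [Preorder ι] (x : ι → X) (l : X) : Prop :=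
  ∃ A : Set X, A ⊆ Y ∧ A.Nonempty ∧ DirectedOn (· ≥ ·) A ∧ IsGLBOn Y A 0 ∧
    ∀ a ∈ A, ∃ α₀, ∀ α, α₀ ≤ α → |x α - l| ≤ a

/-- uo-convergence relative to the sublattice `Y` (test vectors taken in `Y`). -/
def UoConvOn (Y : Set X) {ι : Type*} [Preorder ι] (x : ι → X) (l : X) : Prop :=
  ∀ u ∈ Y, 0 ≤ u → OConvOn Y (fun α => |x α - l| ⊓ u) (0 : X)

end Defs

/-- Cesàro means of a sequence: `cesaro x n = (1/(n+1)) • (x 0 + ⋯ + x n)`. -/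
noncomputable def cesaro {X : Type*} [AddCommGroup X] [Module ℝ X] (x : ℕ → X) (n : ℕ) : X :=
  ((n + 1 : ℝ))⁻¹ • ∑ i ∈ Finset.range (n + 1), x i

section OrderDense

variable {X : Type*} [Lattice X] [AddCommGroup X]

/-- Order dense subsets preserve infima equal to `0`. -/
lemma IsGLBOn.isGLB_zero_of_orderDense {Y A : Set X}
    (hdense : ∀ z : X, 0 < z → ∃ y ∈ Y, 0 < y ∧ y ≤ z) (h : IsGLBOn Y A 0) : IsGLB A 0 := by
  refine ⟨h.2.1, fun z hz => ?_⟩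
  by_contra hz0
  have hpos : 0 < z ⊔ 0 := lt_of_le_not_ge le_sup_right fun hle => hz0 (le_sup_left.trans hle)
  obtain ⟨y, hyY, hy0, hyz⟩ := hdense _ hpos
  exact hy0.not_ge (h.2.2 y hyY fun a ha => hyz.trans (sup_le (hz ha) (h.2.1 ha)))

/-- In an Archimedean lattice-ordered group, every element is the infimum of its upper bounds
in an order dense majorizing set closed under subtraction. -/
lemma le_of_forall_le_of_orderDense [CovariantClass X X (· + ·) (· ≤ ·)]
    (hArch : ∀ a b : X, (∀ n : ℕ, n • a ≤ b) → a ≤ 0) {Y : Set X}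
    (hYsub : ∀ a ∈ Y, ∀ b ∈ Y, a - b ∈ Y)
    (hdense : ∀ z : X, 0 < z → ∃ y ∈ Y, 0 < y ∧ y ≤ z)
    (hmaj : ∀ z : X, ∃ y ∈ Y, z ≤ y) {a w : X}
    (hw : ∀ y ∈ Y, a ≤ y → w ≤ y) : w ≤ a := by
  by_contra hwa
  have hpos : 0 < w ⊔ a - a :=
    sub_pos.2 (lt_of_le_not_ge le_sup_right fun hle => hwa (le_sup_left.trans hle))
  obtain ⟨e, heY, he0, he⟩ := hdense _ hpos
  obtain ⟨v, hvY, hv⟩ := hmaj a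
  have key : ∀ n : ℕ, v - n • e ∈ Y ∧ a ≤ v - n • e := by
    intro n
    induction n with
    | zero => simpa using ⟨hvY, hv⟩
    | succ n ih =>
      rw [succ_nsmul, ← sub_sub]
      exact ⟨hYsub _ ih.1 _ heY, le_sub_comm.1
        (he.trans (sub_le_sub_right (sup_le (hw _ ih.1 ih.2) ih.2) a))⟩
  exact he0.not_ge (hArch e (v - a) fun n => le_sub_comm.1 (key n).2)

end OrderDense

/-- If `Y` is an order dense and majorizing sublattice of an Archimedean
vector lattice `X`, then a net in `Y` order converges to `0` in `Y` iff it order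
converges to `0` in `X`. -/
theorem orderDense_majorizing_oConv_iff
    {X : Type u} [Lattice X] [AddCommGroup X] [Module ℝ X]
    [CovariantClass X X (· + ·) (· ≤ ·)] [PosSMulMono ℝ X]
    (hArch : ∀ a b : X, (∀ n : ℕ, n • a ≤ b) → a ≤ 0)
    (Y : Set X) (hY0 : (0 : X) ∈ Y)
    (hYadd : ∀ a ∈ Y, ∀ b ∈ Y, a + b ∈ Y)
    (hYsmul : ∀ (c : ℝ), ∀ a ∈ Y, c • a ∈ Y)
    (hYsup : ∀ a ∈ Y, ∀ b ∈ Y, a ⊔ b ∈ Y)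
    (hYinf : ∀ a ∈ Y, ∀ b ∈ Y, a ⊓ b ∈ Y)
    (hdense : ∀ z : X, 0 < z → ∃ y ∈ Y, 0 < y ∧ y ≤ z)
    (hmaj : ∀ z : X, ∃ y ∈ Y, z ≤ y)
    {ι : Type v} [Preorder ι] [IsDirected ι (· ≤ ·)] [Nonempty ι]
    (x : ι → X) (hx : ∀ α, x α ∈ Y) :
    OConvOn Y x 0 ↔ OConv x 0 := by
  constructor
  · rintro ⟨A, -, hne, hdir, hglb, hconv⟩
    exact ⟨A, hne, hdir, hglb.isGLB_zero_of_orderDense hdense, hconv⟩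
  · rintro ⟨A, ⟨a₀, ha₀⟩, hdir, hglb, hconv⟩
    have hYsub : ∀ a ∈ Y, ∀ b ∈ Y, a - b ∈ Y := fun a ha b hb => by
      simpa [sub_eq_add_neg] using hYadd a ha _ (hYsmul (-1) b hb)
    refine ⟨{y | y ∈ Y ∧ ∃ a ∈ A, a ≤ y}, fun y hy => hy.1, ?_, ?_, ⟨hY0, ?_, ?_⟩, ?_⟩
    · obtain ⟨y, hyY, hy⟩ := hmaj a₀
      exact ⟨y, hyY, a₀, ha₀, hy⟩
    · rintro y ⟨hyY, a, ha, hay⟩ z ⟨hzY, b, hb, hbz⟩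
      obtain ⟨c, hc, hca, hcb⟩ := hdir a ha b hb
      exact ⟨y ⊓ z, ⟨hYinf y hyY z hzY, c, hc, le_inf (hca.trans hay) (hcb.trans hbz)⟩,
        inf_le_left, inf_le_right⟩
    · rintro y ⟨-, a, ha, hay⟩
      exact (hglb.1 ha).trans hay
    · intro w _ hw
      exact hglb.2 fun a ha => le_of_forall_le_of_orderDense hArch hYsub hdense hmaj
        fun y hyY hay => hw ⟨hyY, a, ha, hay⟩
    · rintro y ⟨-, a, ha, hay⟩
      obtain ⟨α₀, hα₀⟩ := hconv a ha
      exact ⟨α₀, fun α hα => (hα₀ α hα).trans hay⟩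
end

section
/- Let Y be a regular sublattice of an Archimedean vector lattice X, and suppose Y is order complete (in its own right). If (y_α) is an order bounded net in Y (order bounded in Y) that order converges in X to some x ∈ X, then x ∈ Y and y_α order converges to x in Y. -/
open Filter Finset

universe u v

/-- In a regular subset closed under negation, relative suprema are suprema. -/
theorem RegularIn.isLUB {X : Type*} [Lattice X] [AddCommGroup X] [IsOrderedAddMonoid X]
    {Y : Set X} (hreg : RegularIn Y) (hneg : ∀ a ∈ Y, -a ∈ Y)
    {A : Set X} (hA : A ⊆ Y) {l : X} (hl : IsLUBOn Y A l) : IsLUB A l := by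
  obtain ⟨hlY, hub, hleast⟩ := hl
  have hglb : IsGLB (Neg.neg '' A) (-l) := by
    refine hreg _ ?_ _ ⟨hneg l hlY, ?_, ?_⟩
    · rintro _ ⟨a, ha, rfl⟩
      exact hneg a (hA ha)
    · rintro _ ⟨a, ha, rfl⟩
      exact neg_le_neg (hub ha)
    · intro z hz hzl
      exact le_neg_of_le_neg (hleast (-z) (hneg z hz) fun a ha =>
        le_neg_of_le_neg (hzl ⟨a, ha, rfl⟩))
  refine ⟨hub, fun z hz => ?_⟩
  refine neg_le_neg_iff.mp (hglb.2 ?_)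
  rintro _ ⟨a, ha, rfl⟩
  exact neg_le_neg (hz ha)

/-- Relative order completeness gives relative infima of sets bounded below. -/
theorem exists_isGLBOn_of_exists_isLUBOn {X : Type*} [Lattice X] {Y : Set X}
    (hcomp : ∀ A : Set X, A ⊆ Y → A.Nonempty → (∃ u ∈ Y, u ∈ upperBounds A) →
      ∃ l : X, IsLUBOn Y A l)
    {A : Set X} (hA : A ⊆ Y) (hne : A.Nonempty) (hbdd : ∃ u ∈ Y, u ∈ lowerBounds A) :
    ∃ l : X, IsGLBOn Y A l := by
  obtain ⟨u, hu, huA⟩ := hbdd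
  obtain ⟨a, ha⟩ := hne
  obtain ⟨l, hlY, hub, hleast⟩ := hcomp (Y ∩ lowerBounds A) Set.inter_subset_left
    ⟨u, hu, huA⟩ ⟨a, hA ha, fun z hz => hz.2 ha⟩
  exact ⟨l, hlY, fun b hb => hleast b (hA hb) fun z hz => hz.2 hb,
    fun z hz hzA => hub ⟨hz, hzA⟩⟩

/-- If `Y` is a regular, order complete sublattice of an Archimedean vector
lattice `X`, and `(y_α)` is a net in `Y`, order bounded in `Y`, which order converges in
`X` to some `x ∈ X`, then `x ∈ Y` and `y_α` order converges to `x` in `Y`. -/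
theorem regular_orderComplete_oLimit_mem
    {X : Type u} [Lattice X] [AddCommGroup X] [Module ℝ X]
    [CovariantClass X X (· + ·) (· ≤ ·)] [PosSMulMono ℝ X]
    (hArch : ∀ a b : X, (∀ n : ℕ, n • a ≤ b) → a ≤ 0)
    (Y : Set X) (hY0 : (0 : X) ∈ Y)
    (hYadd : ∀ a ∈ Y, ∀ b ∈ Y, a + b ∈ Y)
    (hYsmul : ∀ (c : ℝ), ∀ a ∈ Y, c • a ∈ Y)
    (hYsup : ∀ a ∈ Y, ∀ b ∈ Y, a ⊔ b ∈ Y)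
    (hYinf : ∀ a ∈ Y, ∀ b ∈ Y, a ⊓ b ∈ Y)
    (hreg : RegularIn Y)
    (hYcomp : ∀ A : Set X, A ⊆ Y → A.Nonempty → (∃ u ∈ Y, u ∈ upperBounds A) →
      ∃ l : X, IsLUBOn Y A l)
    {ι : Type v} [Preorder ι] [IsDirected ι (· ≤ ·)] [Nonempty ι]
    (y : ι → X) (hy : ∀ α, y α ∈ Y)
    (hbdd : ∃ u ∈ Y, ∀ α, |y α| ≤ u)
    (x : X) (hconv : OConv y x) :
    x ∈ Y ∧ OConvOn Y y x := by
  have : IsOrderedAddMonoid X :=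
    { add_le_add_left := fun a b h c => by
        simpa only [add_comm _ c] using CovariantClass.elim (μ := (· + ·)) c h }
  have hneg : ∀ a ∈ Y, -a ∈ Y := fun a ha => by simpa using hYsmul (-1) a ha
  obtain ⟨u, hu, hyu⟩ := hbdd
  obtain ⟨A, -, -, hA0, hA⟩ := hconv
  have le_of_forall_sub_le : ∀ p q : X, (∀ a ∈ A, p - q ≤ a) → p ≤ q := fun p q h =>
    sub_nonpos.mp (hA0.2 h)
  have hinf : ∀ α, ∃ l, IsGLBOn Y (y '' Set.Ici α) l := fun α =>
    exists_isGLBOn_of_exists_isLUBOn hYcomp (by rintro _ ⟨β, -, rfl⟩; exact hy β)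
      ⟨y α, α, le_rfl, rfl⟩
      ⟨-u, hneg u hu, by rintro _ ⟨β, -, rfl⟩; exact neg_le.mp ((neg_le_abs _).trans (hyu β))⟩
  choose i hi using hinf
  have hiY : Set.range i ⊆ Y := by rintro _ ⟨α, rfl⟩; exact (hi α).1
  have hi_le : ∀ {α β}, α ≤ β → i α ≤ y β := fun {α β} h => (hi α).2.1 ⟨β, h, rfl⟩
  obtain ⟨L, hL⟩ := hYcomp (Set.range i) hiY (Set.range_nonempty i)
    ⟨u, hu, by rintro _ ⟨α, rfl⟩; exact (hi_le le_rfl).trans ((le_abs_self _).trans (hyu α))⟩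
  have hLx : L ≤ x := by
    refine (hreg.isLUB hneg hiY hL).2 ?_
    rintro _ ⟨α, rfl⟩
    refine le_of_forall_sub_le _ _ fun a ha => ?_
    obtain ⟨α₀, h⟩ := hA a ha
    obtain ⟨β, hαβ, hβ⟩ := exists_ge_ge α α₀
    exact (sub_le_sub_right (hi_le hαβ) x).trans ((le_abs_self _).trans (h β hβ))
  have hxL : x ≤ L := by
    refine le_of_forall_sub_le _ _ fun a ha => ?_
    obtain ⟨α₀, h⟩ := hA a ha
    have hxi : x - a ≤ i α₀ := by
      refine (hreg _ (by rintro _ ⟨β, -, rfl⟩; exact hy β) _ (hi α₀)).2 ?_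
      rintro _ ⟨β, hβ, rfl⟩
      have hβa : x - y β ≤ a := by
        simpa using (neg_le_abs (y β - x)).trans (h β hβ)
      exact sub_le_comm.mp hβa
    exact sub_le_comm.mp (hxi.trans (hL.2.1 ⟨α₀, rfl⟩))
  obtain rfl : x = L := le_antisymm hxL hLx
  have hxY : x ∈ Y := hL.1
  have habs : ∀ a ∈ Y, |a| ∈ Y := fun a ha => hYsup a ha _ (hneg a ha)
  have hdY : ∀ α, |y α - x| ∈ Y := fun α => habs _ (by
    simpa [sub_eq_add_neg] using hYadd _ (hy α) _ (hneg x hxY))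
  have htail : ∀ α, (fun β => |y β - x|) '' Set.Ici α ⊆ Y := by
    rintro α _ ⟨β, -, rfl⟩
    exact hdY β
  have hsup : ∀ α, ∃ l, IsLUBOn Y ((fun β => |y β - x|) '' Set.Ici α) l := fun α => by
    refine hYcomp _ (htail α) ⟨_, α, le_rfl, rfl⟩ ⟨u + |x|, hYadd u hu _ (habs x hxY), ?_⟩
    rintro _ ⟨β, -, rfl⟩
    have hsub : |y β - x| ≤ |y β| + |x| := by
      simpa [sub_eq_add_neg] using abs_add_le (y β) (-x)
    exact hsub.trans (add_le_add_left (hyu β) _)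
  choose s hs using hsup
  have hle_s : ∀ {α β}, α ≤ β → |y β - x| ≤ s α := fun {α β} h => (hs α).2.1 ⟨β, h, rfl⟩
  have hs_anti : Antitone s := fun α β hαβ => by
    refine (hs β).2.2 _ (hs α).1 ?_
    rintro _ ⟨γ, hγ, rfl⟩
    exact hle_s (hαβ.trans hγ)
  refine ⟨hxY, Set.range s, ?_, Set.range_nonempty s, ?_, ⟨hY0, ?_, ?_⟩, ?_⟩
  · rintro _ ⟨α, rfl⟩
    exact (hs α).1
  · rintro _ ⟨α, rfl⟩ _ ⟨β, rfl⟩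
    obtain ⟨γ, hα, hβ⟩ := exists_ge_ge α β
    exact ⟨s γ, ⟨γ, rfl⟩, hs_anti hα, hs_anti hβ⟩
  · rintro _ ⟨α, rfl⟩
    exact (abs_nonneg _).trans (hle_s le_rfl)
  · intro z _ hz
    refine hA0.2 fun a ha => ?_
    obtain ⟨α₀, h⟩ := hA a ha
    refine (hz ⟨α₀, rfl⟩).trans ((hreg.isLUB hneg (htail α₀) (hs α₀)).2 ?_)
    rintro _ ⟨β, hβ, rfl⟩
    exact h β hβ
  · rintro _ ⟨α, rfl⟩
    exact ⟨α, fun β hβ => hle_s hβ⟩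
end

section
/- Let Y be a regular sublattice of an Archimedean vector lattice X. Then for every net (x_α) in Y that is order bounded in Y, the net (x_α) order converges to 0 in Y if and only if it order converges to 0 in X. -/
open Filter Finset

universe u v

/-- In an Archimedean ordered group, if `Y` is a subgroup, `T ⊆ Y` is nonempty and bounded above
in `Y`, then the differences of upper bounds of `T` in `Y` and elements of `T` have infimum `0`
in `Y`. -/
theorem isGLBOn_upperBounds_sub {X : Type*} [Lattice X] [AddCommGroup X]
    [CovariantClass X X (· + ·) (· ≤ ·)]
    (hArch : ∀ a b : X, (∀ n : ℕ, n • a ≤ b) → a ≤ 0)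
    {Y T : Set X} (hY0 : (0 : X) ∈ Y) (hYsub : ∀ a ∈ Y, ∀ b ∈ Y, a - b ∈ Y)
    (hT : T.Nonempty) (hbdd : ∃ u ∈ Y, u ∈ upperBounds T) :
    IsGLBOn Y {d | ∃ y ∈ Y, y ∈ upperBounds T ∧ ∃ t ∈ T, d = y - t} 0 := by
  obtain ⟨t₀, ht₀⟩ := hT
  obtain ⟨u, huY, hu⟩ := hbdd
  refine ⟨hY0, ?_, fun w hwY hw => ?_⟩
  · rintro _ ⟨y, -, hy, t, ht, rfl⟩
    exact sub_nonneg.2 (hy ht)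
  · have key : ∀ n : ℕ, u - n • w ∈ Y ∧ u - n • w ∈ upperBounds T := by
      intro n
      induction n with
      | zero => simpa using And.intro huY hu
      | succ n ih =>
        rw [succ_nsmul, ← sub_sub]
        exact ⟨hYsub _ ih.1 _ hwY,
          fun t ht => le_sub_comm.1 (hw ⟨_, ih.1, ih.2, t, ht, rfl⟩)⟩
    exact hArch w (u - t₀) fun n => le_sub_comm.1 ((key n).2 ht₀)

/-- If `Y` is a regular sublattice of an Archimedean vector lattice `X`,
then a net in `Y` which is order bounded in `Y` order converges to `0` in `Y` iff it
order converges to `0` in `X`. -/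
theorem regular_orderBounded_oConv_iff
    {X : Type u} [Lattice X] [AddCommGroup X] [Module ℝ X]
    [CovariantClass X X (· + ·) (· ≤ ·)] [PosSMulMono ℝ X]
    (hArch : ∀ a b : X, (∀ n : ℕ, n • a ≤ b) → a ≤ 0)
    (Y : Set X) (hY0 : (0 : X) ∈ Y)
    (hYadd : ∀ a ∈ Y, ∀ b ∈ Y, a + b ∈ Y)
    (hYsmul : ∀ (c : ℝ), ∀ a ∈ Y, c • a ∈ Y)
    (hYsup : ∀ a ∈ Y, ∀ b ∈ Y, a ⊔ b ∈ Y)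
    (hYinf : ∀ a ∈ Y, ∀ b ∈ Y, a ⊓ b ∈ Y)
    (hreg : RegularIn Y)
    {ι : Type v} [Preorder ι] [IsDirected ι (· ≤ ·)] [Nonempty ι]
    (x : ι → X) (hx : ∀ α, x α ∈ Y)
    (hbdd : ∃ u ∈ Y, ∀ α, |x α| ≤ u) :
    OConvOn Y x 0 ↔ OConv x 0 := by
  have hYneg : ∀ a ∈ Y, -a ∈ Y := fun a ha => by simpa using hYsmul (-1) a ha
  have hYsub : ∀ a ∈ Y, ∀ b ∈ Y, a - b ∈ Y := fun a ha b hb => by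
    simpa [sub_eq_add_neg] using hYadd a ha _ (hYneg b hb)
  have hxabs : ∀ α, |x α| ∈ Y := fun α => hYsup _ (hx α) _ (hYneg _ (hx α))
  constructor
  · rintro ⟨A, hAY, hne, hdir, hglb, hA⟩
    exact ⟨A, hne, hdir, hreg A hAY 0 hglb, hA⟩
  · rintro ⟨A, -, -, hglb, hA⟩
    obtain ⟨u, huY, hu⟩ := hbdd
    refine ⟨{y | y ∈ Y ∧ ∃ α₀, ∀ α, α₀ ≤ α → |x α - 0| ≤ y}, fun y hy => hy.1,
      ⟨u, huY, Classical.arbitrary ι, fun α _ => by simpa using hu α⟩, ?_,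
      ⟨hY0, ?_, ?_⟩, fun y hy => hy.2⟩
    · rintro y ⟨hyY, α, hα⟩ z ⟨hzY, β, hβ⟩
      obtain ⟨γ, hαγ, hβγ⟩ := exists_ge_ge α β
      exact ⟨y ⊓ z, ⟨hYinf y hyY z hzY, γ, fun δ hδ =>
        le_inf (hα δ (hαγ.trans hδ)) (hβ δ (hβγ.trans hδ))⟩, inf_le_left, inf_le_right⟩
    · rintro y ⟨-, α, hα⟩
      exact (abs_nonneg _).trans (hα α le_rfl)
    · intro z _ hz
      refine hglb.2 fun a ha => ?_
      obtain ⟨α, hα⟩ := hA a ha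
      have hinf := isGLBOn_upperBounds_sub hArch (T := (fun β => |x β|) '' Set.Ici α) hY0 hYsub
        (Set.nonempty_Ici.image _) ⟨u, huY, by rintro _ ⟨β, -, rfl⟩; exact hu β⟩
      refine sub_nonpos.1 ((hreg _ ?_ 0 hinf).2 ?_)
      · rintro _ ⟨y, hyY, -, _, ⟨β, -, rfl⟩, rfl⟩
        exact hYsub y hyY _ (hxabs β)
      · rintro _ ⟨y, hyY, hy, _, ⟨β, hβ, rfl⟩, rfl⟩
        refine sub_le_sub (hz ⟨hyY, α, fun δ hδ => ?_⟩) (by simpa using hα β hβ)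
        simpa using hy ⟨δ, hδ, rfl⟩
end

section
/- Let (Ω, Σ, μ) be a measure space (μ countably additive, not necessarily finite) and let L₀(μ) be the vector lattice of real-valued measurable functions on Ω modulo μ-almost everywhere equality, with the almost everywhere pointwise order. For a sequence (x_n) in L₀(μ) the following are equivalent: (1) (x_n) uo-converges to some element of L₀(μ); (2) (x_n) is uo-Cauchy; (3) (x_n) converges μ-almost everywhere (to some measurable function); (4) (x_n) order converges to some element of L₀(μ); (5) (x_n) is order Cauchy. In this case, (x_n) is order bounded in L₀(μ) and the limits in (1), (3) and (4) coincide. -/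
open Filter Finset

universe u v

open MeasureTheory

namespace MeasureTheory.AEEqFun

variable {α : Type*} [MeasurableSpace α] {μ : Measure α} {ι : Type*} [Preorder ι]

/-- A countable net in `L₀(μ)` order converging to `0` converges to `0` almost everywhere. -/
theorem ae_tendsto_zero_of_oConv [Countable ι] [IsDirectedOrder ι] [Nonempty ι]
    {f : ι → α →ₘ[μ] ℝ} (h : OConv f 0) :
    ∀ᵐ t ∂μ, Tendsto (fun i => f i t) atTop (nhds 0) := by
  obtain ⟨A, ⟨a₀, ha₀⟩, -, hglb, hA⟩ := h
  set g : α → ENNReal := fun t => limsup (fun i => ‖f i t‖ₑ) atTop with hg_def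
  have hg : Measurable g := by
    have : g = fun t => ⨅ i : ι, ⨆ j : Set.Ici i, ‖f j t‖ₑ := by
      funext t
      simp only [hg_def, atTop_basis.limsup_eq_iInf_iSup, iInf_pos, iSup_subtype]
    rw [this]
    exact .iInf fun i => .iSup fun j => (f j).measurable.enorm
  have hle : ∀ a ∈ A, ∀ᵐ t ∂μ, 0 ≤ a t ∧ g t ≤ ENNReal.ofReal (a t) := by
    intro a ha
    obtain ⟨i₀, hi₀⟩ := hA a ha
    have hae : ∀ᵐ t ∂μ, ∀ i, i₀ ≤ i → |f i t| ≤ a t := by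
      rw [ae_all_iff]
      intro i
      by_cases hi : i₀ ≤ i
      · have := hi₀ i hi
        rw [sub_zero, ← coeFn_le] at this
        filter_upwards [this, coeFn_abs (f i)] with t h₁ h₂ _
        rwa [← h₂]
      · exact .of_forall fun t hi' => absurd hi' hi
    filter_upwards [hae] with t ht
    refine ⟨(abs_nonneg _).trans (ht i₀ le_rfl), limsup_le_of_le (by isBoundedDefault) ?_⟩
    filter_upwards [eventually_ge_atTop i₀] with i hi
    rw [Real.enorm_eq_ofReal_abs]
    exact ENNReal.ofReal_le_ofReal (ht i hi)
  have hmeas : AEStronglyMeasurable (fun t => (g t).toReal) μ :=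
    hg.ennreal_toReal.aestronglyMeasurable
  have hlb : mk _ hmeas ≤ (0 : α →ₘ[μ] ℝ) := by
    refine hglb.2 fun a ha => ?_
    rw [← coeFn_le]
    filter_upwards [hle a ha, coeFn_mk _ hmeas] with t ht hmk
    rw [hmk]
    exact ENNReal.toReal_le_of_le_ofReal ht.1 ht.2
  rw [← coeFn_le] at hlb
  filter_upwards [hlb, coeFn_mk _ hmeas, coeFn_zero (α := α) (μ := μ) (β := ℝ), hle a₀ ha₀]
    with t h₁ h₂ h₃ h₄
  rw [h₂, h₃] at h₁
  have hfin : g t ≠ ⊤ := ne_top_of_le_ne_top ENNReal.ofReal_ne_top h₄.2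
  have hzero : g t = 0 :=
    ((ENNReal.toReal_eq_zero_iff _).1 (le_antisymm h₁ ENNReal.toReal_nonneg)).resolve_right hfin
  rw [tendsto_zero_iff_enorm_tendsto_zero]
  exact tendsto_of_le_liminf_of_limsup_le bot_le hzero.le

/-- A net in `L₀(μ)` dominated, in the sense of order convergence, by a sequence of measurable
functions decreasing to `0` almost everywhere is order convergent. -/
theorem oConv_of_dominated {f : ι → α →ₘ[μ] ℝ} {l : α →ₘ[μ] ℝ} {c : ℕ → α → ℝ}
    (hc : ∀ N, AEStronglyMeasurable (c N) μ) (hanti : ∀ᵐ t ∂μ, Antitone fun N => c N t)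
    (hlim : ∀ᵐ t ∂μ, Tendsto (fun N => c N t) atTop (nhds 0))
    (hdom : ∀ N, ∃ i₀, ∀ i, i₀ ≤ i → ∀ᵐ t ∂μ, |f i t - l t| ≤ c N t) : OConv f l := by
  have hmk : ∀ᵐ t ∂μ, ∀ N, mk (c N) (hc N) t = c N t := ae_all_iff.2 fun N => coeFn_mk _ _
  refine ⟨Set.range fun N => mk (c N) (hc N), Set.range_nonempty _, ?_, ⟨?_, ?_⟩, ?_⟩
  · refine directedOn_range.2 (directed_of_isDirected_le fun M N hMN => ?_)
    rw [ge_iff_le, ← coeFn_le]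
    filter_upwards [hmk, hanti] with t h₁ h₂
    rw [h₁, h₁]
    exact h₂ hMN
  · rintro _ ⟨N, rfl⟩
    rw [← coeFn_le]
    filter_upwards [hmk, hanti, hlim, coeFn_zero (α := α) (μ := μ) (β := ℝ)] with t h₁ h₂ h₃ h₄
    rw [h₁, h₄]
    exact h₂.le_of_tendsto h₃ N
  · intro y hy
    have hy' : ∀ᵐ t ∂μ, ∀ N, y t ≤ mk (c N) (hc N) t :=
      ae_all_iff.2 fun N => coeFn_le.2 (hy ⟨N, rfl⟩)
    rw [← coeFn_le]
    filter_upwards [hmk, hlim, hy', coeFn_zero (α := α) (μ := μ) (β := ℝ)] with t h₁ h₂ h₃ h₄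
    rw [h₄]
    exact ge_of_tendsto' h₂ fun N => h₁ N ▸ h₃ N
  · rintro _ ⟨N, rfl⟩
    obtain ⟨i₀, hi₀⟩ := hdom N
    refine ⟨i₀, fun i hi => ?_⟩
    rw [← coeFn_le]
    filter_upwards [hi₀ i hi, hmk, coeFn_abs (f i - l), coeFn_sub (f i) l] with t h₁ h₂ h₃ h₄
    rw [h₃, h₄, h₂]
    exact h₁

/-- The same domination criterion for unbounded order convergence. -/
theorem uoConv_of_dominated {f : ι → α →ₘ[μ] ℝ} {l : α →ₘ[μ] ℝ} {c : ℕ → α → ℝ}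
    (hc : ∀ N, AEStronglyMeasurable (c N) μ) (hanti : ∀ᵐ t ∂μ, Antitone fun N => c N t)
    (hlim : ∀ᵐ t ∂μ, Tendsto (fun N => c N t) atTop (nhds 0))
    (hdom : ∀ N, ∃ i₀, ∀ i, i₀ ≤ i → ∀ᵐ t ∂μ, |f i t - l t| ≤ c N t) : UoConv f l := by
  intro u hu
  refine oConv_of_dominated hc hanti hlim fun N => ?_
  obtain ⟨i₀, hi₀⟩ := hdom N
  refine ⟨i₀, fun i hi => ?_⟩
  rw [← coeFn_le] at hu
  filter_upwards [hi₀ i hi, hu, coeFn_inf |f i - l| u, coeFn_abs (f i - l), coeFn_sub (f i) l,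
    coeFn_zero (α := α) (μ := μ) (β := ℝ)] with t h₁ h₂ h₃ h₄ h₅ h₆
  rw [h₆] at h₂
  rw [h₃, h₄, h₅, h₆, Pi.sub_apply, Pi.zero_apply, sub_zero,
    abs_of_nonneg (le_inf (abs_nonneg _) h₂)]
  exact inf_le_left.trans h₁

/-- A countable net in `L₀(μ)` that uo-converges to `l` converges to `l` almost everywhere. -/
theorem ae_tendsto_of_uoConv [Countable ι] [IsDirectedOrder ι] [Nonempty ι]
    {f : ι → α →ₘ[μ] ℝ} {l : α →ₘ[μ] ℝ} (h : UoConv f l) :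
    ∀ᵐ t ∂μ, Tendsto (fun i => f i t) atTop (nhds (l t)) := by
  have hone : (0 : α →ₘ[μ] ℝ) ≤ 1 := by
    rw [← coeFn_le]
    filter_upwards [coeFn_zero (α := α) (μ := μ) (β := ℝ),
      coeFn_one (α := α) (μ := μ) (β := ℝ)] with t h₁ h₂
    simp [h₁, h₂]
  have hae : ∀ᵐ t ∂μ, ∀ i, (|f i - l| ⊓ 1 : α →ₘ[μ] ℝ) t = |f i t - l t| ⊓ 1 := by
    rw [ae_all_iff]
    intro i
    filter_upwards [coeFn_inf |f i - l| 1, coeFn_abs (f i - l), coeFn_sub (f i) l,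
      coeFn_one (α := α) (μ := μ) (β := ℝ)] with t h₁ h₂ h₃ h₄
    rw [h₁, h₂, h₃, h₄, Pi.sub_apply, Pi.one_apply]
  filter_upwards [hae, ae_tendsto_zero_of_oConv (h 1 hone)] with t h₁ h₂
  simp only [h₁] at h₂
  rw [tendsto_iff_dist_tendsto_zero]
  refine h₂.congr' ?_
  filter_upwards [h₂.eventually_lt_const one_pos] with i hi
  rw [Real.dist_eq, inf_eq_left]
  exact (inf_lt_iff.1 hi).elim le_of_lt fun h => absurd h (lt_irrefl _)

/-- An a.e. convergent sequence is dominated by a sequence decreasing to `0`. -/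
theorem exists_dominating_of_ae_tendsto {x : ℕ → α →ₘ[μ] ℝ} {g : α → ℝ} (hg : Measurable g)
    (h : ∀ᵐ t ∂μ, Tendsto (fun n => x n t) atTop (nhds (g t))) :
    ∃ c : ℕ → α → ℝ, (∀ N, Measurable (c N)) ∧ (∀ᵐ t ∂μ, Antitone fun N => c N t) ∧
      (∀ᵐ t ∂μ, Tendsto (fun N => c N t) atTop (nhds 0)) ∧
      ∀ᵐ t ∂μ, ∀ N n, N ≤ n → |x n t - g t| ≤ c N t := by
  have hbdd : ∀ᵐ t ∂μ, ∀ N, BddAbove (Set.range fun k => |x (N + k) t - g t|) := by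
    filter_upwards [h] with t ht N
    have : Tendsto (fun n => |x n t - g t|) atTop (nhds |g t - g t|) := (ht.sub_const _).abs
    refine this.bddAbove_range.mono ?_
    rintro _ ⟨k, rfl⟩
    exact ⟨N + k, rfl⟩
  have hdom : ∀ᵐ t ∂μ, ∀ N n, N ≤ n → |x n t - g t| ≤ ⨆ k, |x (N + k) t - g t| := by
    filter_upwards [hbdd] with t ht N n hn
    obtain ⟨k, rfl⟩ := Nat.exists_eq_add_of_le hn
    exact le_ciSup (ht N) k
  refine ⟨fun N t => ⨆ k, |x (N + k) t - g t|, fun N => ?_, ?_, ?_, hdom⟩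
  · exact .iSup fun k => ((x (N + k)).measurable.sub hg).abs
  · filter_upwards [hdom] with t ht M N hMN
    exact ciSup_le fun k => ht M (N + k) (by lia)
  · filter_upwards [h] with t ht
    rw [Metric.tendsto_atTop] at ht ⊢
    intro ε hε
    obtain ⟨N, hN⟩ := ht (ε / 2) (half_pos hε)
    refine ⟨N, fun n hn => ?_⟩
    rw [Real.dist_0_eq_abs, abs_of_nonneg (Real.iSup_nonneg fun k => abs_nonneg _)]
    exact (ciSup_le fun k => (hN (n + k) (by lia)).le).trans_lt (half_lt_self hε)

/-- A uo-Cauchy sequence converges almost everywhere to a measurable function. -/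
theorem ae_tendsto_of_uoCauchy {x : ℕ → α →ₘ[μ] ℝ} (h : UoCauchy x) :
    ∃ g : α → ℝ, Measurable g ∧ ∀ᵐ t ∂μ, Tendsto (fun n => x n t) atTop (nhds (g t)) := by
  have hsub : ∀ᵐ t ∂μ, ∀ p : ℕ × ℕ, (x p.1 - x p.2) t = x p.1 t - x p.2 t :=
    ae_all_iff.2 fun p => coeFn_sub _ _
  have hlim : ∀ᵐ t ∂μ, ∃ a, Tendsto (fun n => x n t) atTop (nhds a) := by
    filter_upwards [ae_tendsto_of_uoConv h, hsub, coeFn_zero (α := α) (μ := μ) (β := ℝ)]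
      with t h₁ h₂ h₃
    refine cauchySeq_tendsto_of_complete (cauchySeq_iff_tendsto_dist_atTop_0.2 ?_)
    simp only [h₂, h₃] at h₁
    simpa [Real.dist_eq] using h₁.abs
  obtain ⟨g, hg, hgt⟩ :=
    measurable_limit_of_tendsto_metrizable_ae (fun n => (x n).measurable.aemeasurable) hlim
  exact ⟨g, hg, hgt⟩

/-- A.e. convergence to `l` gives every order-theoretic form of convergence. -/
theorem oConv_and_cauchy_of_ae_tendsto {x : ℕ → α →ₘ[μ] ℝ} {l : α →ₘ[μ] ℝ}
    (h : ∀ᵐ t ∂μ, Tendsto (fun n => x n t) atTop (nhds (l t))) :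
    OConv x l ∧ UoConv x l ∧ OCauchy x ∧ UoCauchy x := by
  obtain ⟨c, hc, hanti, hlim, hdom⟩ := exists_dominating_of_ae_tendsto l.measurable h
  have hdom₁ : ∀ N, ∃ i₀, ∀ i, i₀ ≤ i → ∀ᵐ t ∂μ, |x i t - l t| ≤ c N t := fun N =>
    ⟨N, fun i hi => by filter_upwards [hdom] with t ht using ht N i hi⟩
  have hanti₂ : ∀ᵐ t ∂μ, Antitone fun N => c N t + c N t := by
    filter_upwards [hanti] with t ht using ht.add ht
  have hlim₂ : ∀ᵐ t ∂μ, Tendsto (fun N => c N t + c N t) atTop (nhds 0) := by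
    filter_upwards [hlim] with t ht
    simpa using ht.add ht
  have hdom₂ : ∀ N, ∃ i₀ : ℕ × ℕ, ∀ i, i₀ ≤ i →
      ∀ᵐ t ∂μ, |(x i.1 - x i.2) t - (0 : α →ₘ[μ] ℝ) t| ≤ c N t + c N t := by
    refine fun N => ⟨(N, N), fun i hi => ?_⟩
    filter_upwards [hdom, coeFn_sub (x i.1) (x i.2), coeFn_zero (α := α) (μ := μ) (β := ℝ)]
      with t h₁ h₂ h₃
    rw [h₂, h₃, Pi.sub_apply, Pi.zero_apply, sub_zero]
    refine (abs_sub_le _ (l t) _).trans (add_le_add (h₁ N i.1 hi.1) ?_)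
    rw [abs_sub_comm]
    exact h₁ N i.2 hi.2
  have hc₁ := fun N => (hc N).aestronglyMeasurable (μ := μ)
  have hc₂ := fun N => (hc₁ N).add (hc₁ N)
  exact ⟨oConv_of_dominated hc₁ hanti hlim hdom₁, uoConv_of_dominated hc₁ hanti hlim hdom₁,
    oConv_of_dominated hc₂ hanti₂ hlim₂ hdom₂, uoConv_of_dominated hc₂ hanti₂ hlim₂ hdom₂⟩

/-- An a.e. convergent sequence is order bounded in `L₀(μ)`. -/
theorem exists_abs_le_of_ae_tendsto {x : ℕ → α →ₘ[μ] ℝ} {g : α → ℝ} (hg : Measurable g)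
    (h : ∀ᵐ t ∂μ, Tendsto (fun n => x n t) atTop (nhds (g t))) :
    ∃ u : α →ₘ[μ] ℝ, ∀ n, |x n| ≤ u := by
  obtain ⟨c, hc, -, -, hdom⟩ := exists_dominating_of_ae_tendsto hg h
  have hu : AEStronglyMeasurable (fun t => c 0 t + |g t|) μ :=
    ((hc 0).add hg.abs).aestronglyMeasurable
  refine ⟨mk _ hu, fun n => ?_⟩
  rw [← coeFn_le]
  filter_upwards [hdom, coeFn_mk _ hu, coeFn_abs (x n)] with t h₁ h₂ h₃
  rw [h₂, h₃, ← sub_le_iff_le_add]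
  exact (abs_sub_abs_le_abs_sub _ _).trans (h₁ 0 n (Nat.zero_le n))

/-- A countable net in `L₀(μ)` order converging to `l` converges to `l` almost everywhere. -/
theorem ae_tendsto_of_oConv [Countable ι] [IsDirectedOrder ι] [Nonempty ι]
    {f : ι → α →ₘ[μ] ℝ} {l : α →ₘ[μ] ℝ} (h : OConv f l) :
    ∀ᵐ t ∂μ, Tendsto (fun i => f i t) atTop (nhds (l t)) := by
  have hsub : OConv (fun i => f i - l) 0 := by simpa only [OConv, sub_zero] using h
  have hae : ∀ᵐ t ∂μ, ∀ i, (f i - l) t = f i t - l t := ae_all_iff.2 fun i => coeFn_sub _ _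
  filter_upwards [ae_tendsto_zero_of_oConv hsub, hae] with t h₁ h₂
  rw [← tendsto_sub_nhds_zero_iff]
  exact h₁.congr h₂

/-- In `L₀(μ)`, an order Cauchy sequence is uo-Cauchy. -/
theorem uoCauchy_of_oCauchy {x : ℕ → α →ₘ[μ] ℝ} (h : OCauchy x) : UoCauchy x := by
  obtain ⟨A, hne, hdir, hglb, hA⟩ := h
  refine fun u hu => ⟨A, hne, hdir, hglb, fun a ha => ?_⟩
  obtain ⟨p₀, hp₀⟩ := hA a ha
  refine ⟨p₀, fun p hp => le_trans ?_ (hp₀ p hp)⟩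
  rw [← coeFn_le] at hu ⊢
  filter_upwards [hu, coeFn_abs (x p.1 - x p.2 - 0), coeFn_inf |x p.1 - x p.2 - 0| u,
    coeFn_abs (|x p.1 - x p.2 - 0| ⊓ u), coeFn_zero (α := α) (μ := μ) (β := ℝ)]
    with t h₁ h₂ h₃ h₄ h₅
  rw [h₅] at h₁
  rw [sub_zero (|x p.1 - x p.2 - 0| ⊓ u), h₄, h₃, h₂,
    abs_of_nonneg (le_inf (abs_nonneg _) h₁)]
  exact inf_le_left

end MeasureTheory.AEEqFun

/-- For a sequence `(x_n)` in `L₀(μ)` (measurable functions modulo a.e.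
equality) the following are equivalent: uo-convergence, uo-Cauchyness, a.e. convergence
(to some measurable function), order convergence, and order Cauchyness. In this case the
sequence is order bounded and the uo-, order and a.e. limits coincide. -/
theorem L0_uo_ae_order_equiv
    {α : Type u} [MeasurableSpace α] (μ : Measure α)
    (x : ℕ → (α →ₘ[μ] ℝ)) :
    ((∃ l : α →ₘ[μ] ℝ, UoConv x l) ↔ UoCauchy x) ∧
    (UoCauchy x ↔ ∃ g : α → ℝ, Measurable g ∧
        ∀ᵐ t ∂μ, Filter.Tendsto (fun n => x n t) Filter.atTop (nhds (g t))) ∧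
    (UoCauchy x ↔ ∃ l : α →ₘ[μ] ℝ, OConv x l) ∧
    (UoCauchy x ↔ OCauchy x) ∧
    (UoCauchy x →
      (∃ u : α →ₘ[μ] ℝ, ∀ n, |x n| ≤ u) ∧
      ∀ l : α →ₘ[μ] ℝ, UoConv x l → OConv x l ∧
        ∀ᵐ t ∂μ, Filter.Tendsto (fun n => x n t) Filter.atTop (nhds (l t))) := by
  have hcauchy : UoCauchy x → ∃ l : α →ₘ[μ] ℝ,
      ∀ᵐ t ∂μ, Filter.Tendsto (fun n => x n t) Filter.atTop (nhds (l t)) := by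
    intro h
    obtain ⟨g, hg, hgt⟩ := AEEqFun.ae_tendsto_of_uoCauchy h
    refine ⟨AEEqFun.mk g hg.aestronglyMeasurable, ?_⟩
    filter_upwards [hgt, AEEqFun.coeFn_mk g hg.aestronglyMeasurable] with t h₁ h₂
    rwa [h₂]
  refine ⟨⟨?_, ?_⟩, ⟨AEEqFun.ae_tendsto_of_uoCauchy, ?_⟩, ⟨?_, ?_⟩,
    ⟨?_, AEEqFun.uoCauchy_of_oCauchy⟩, fun h => ⟨?_, fun l hl => ?_⟩⟩
  · rintro ⟨l, hl⟩
    exact (AEEqFun.oConv_and_cauchy_of_ae_tendsto (AEEqFun.ae_tendsto_of_uoConv hl)).2.2.2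
  · intro h
    obtain ⟨l, hl⟩ := hcauchy h
    exact ⟨l, (AEEqFun.oConv_and_cauchy_of_ae_tendsto hl).2.1⟩
  · rintro ⟨g, hg, hgt⟩
    refine (AEEqFun.oConv_and_cauchy_of_ae_tendsto
      (l := AEEqFun.mk g hg.aestronglyMeasurable) ?_).2.2.2
    filter_upwards [hgt, AEEqFun.coeFn_mk g hg.aestronglyMeasurable] with t h₁ h₂
    rwa [h₂]
  · intro h
    obtain ⟨l, hl⟩ := hcauchy h
    exact ⟨l, (AEEqFun.oConv_and_cauchy_of_ae_tendsto hl).1⟩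
  · rintro ⟨l, hl⟩
    exact (AEEqFun.oConv_and_cauchy_of_ae_tendsto (AEEqFun.ae_tendsto_of_oConv hl)).2.2.2
  · intro h
    obtain ⟨l, hl⟩ := hcauchy h
    exact (AEEqFun.oConv_and_cauchy_of_ae_tendsto hl).2.2.1
  · obtain ⟨g, hg, hgt⟩ := AEEqFun.ae_tendsto_of_uoCauchy h
    exact AEEqFun.exists_abs_le_of_ae_tendsto hg hgt
  · have hlim := AEEqFun.ae_tendsto_of_uoConv hl
    exact ⟨(AEEqFun.oConv_and_cauchy_of_ae_tendsto hlim).1, hlim⟩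
end

section
/- Let X be an Archimedean vector lattice with a weak unit e > 0. Then a net (x_α) in X uo-converges to 0 in X if and only if |x_α| ∧ e order converges to 0 in X. -/
open Filter Finset

universe u v

section LatticeOrderedGroup

variable {X : Type*} [Lattice X] [AddCommGroup X] [AddLeftMono X]

theorem inf_add_le_inf_add_inf {y p q : X} (hy : 0 ≤ y) (hp : 0 ≤ p) (hq : 0 ≤ q) :
    y ⊓ (p + q) ≤ y ⊓ p + y ⊓ q := by
  rw [add_inf, inf_add, inf_add]
  refine le_inf (le_inf ?_ ?_) (le_inf ?_ inf_le_right)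
  · exact inf_le_left.trans (le_add_of_nonneg_left hy)
  · exact inf_le_left.trans (le_add_of_nonneg_left hp)
  · exact inf_le_left.trans (le_add_of_nonneg_right hq)

theorem inf_nsmul_le_nsmul_inf {y e : X} (hy : 0 ≤ y) (he : 0 ≤ e) (n : ℕ) :
    y ⊓ n • e ≤ n • (y ⊓ e) := by
  induction n with
  | zero => simp
  | succ n ih =>
    rw [succ_nsmul, succ_nsmul]
    exact (inf_add_le_inf_add_inf hy (nsmul_nonneg he n) he).trans (by gcongr)

/-- If `w + u ⊓ n • e ≤ u` for all `n`, then every multiple of `w ⊓ e` lies below `u`. -/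
theorem nsmul_inf_le_of_add_inf_nsmul_le {w u e : X} (hu : 0 ≤ u)
    (h : ∀ n : ℕ, w + u ⊓ n • e ≤ u) (n : ℕ) : n • (w ⊓ e) ≤ u := by
  induction n with
  | zero => simpa using hu
  | succ n ih =>
    rw [succ_nsmul']
    exact (add_le_add inf_le_left (le_inf ih (nsmul_le_nsmul_right inf_le_right n))).trans (h n)

end LatticeOrderedGroup

theorem le_of_forall_le_nsmul_add {X : Type*} [Lattice X] [AddCommGroup X] [Module ℝ X]
    [AddLeftMono X] [PosSMulMono ℝ X] {A : Set X} (hA : IsGLB A 0) (hne : A.Nonempty)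
    {w r : X} (n : ℕ) (h : ∀ a ∈ A, w ≤ n • a + r) : w ≤ r := by
  rcases n.eq_zero_or_pos with rfl | hn
  · obtain ⟨a, ha⟩ := hne
    simpa using h a ha
  · have hn' : (0 : ℝ) < n := by exact_mod_cast hn
    have hle : (n : ℝ)⁻¹ • (w - r) ≤ 0 := hA.2 fun a ha => by
      rw [inv_smul_le_iff_of_pos hn', Nat.cast_smul_eq_nsmul]
      exact sub_le_iff_le_add.2 (h a ha)
    rw [inv_smul_le_iff_of_pos hn', smul_zero] at hle
    exact sub_nonpos.1 hle

/-- In an Archimedean vector lattice with a weak unit `e > 0`, a net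
`(x_α)` uo-converges to `0` iff `|x_α| ⊓ e` order converges to `0`. -/
theorem uoConv_iff_inf_weakUnit
    {X : Type u} [Lattice X] [AddCommGroup X] [Module ℝ X]
    [CovariantClass X X (· + ·) (· ≤ ·)] [PosSMulMono ℝ X]
    (hArch : ∀ a b : X, (∀ n : ℕ, n • a ≤ b) → a ≤ 0)
    (e : X) (he : 0 < e)
    (hweak : ∀ a : X, 0 ≤ a → a ⊓ e = 0 → a = 0)
    {ι : Type v} [Preorder ι] [IsDirected ι (· ≤ ·)] [Nonempty ι]
    (x : ι → X) :
    UoConv x 0 ↔ OConv (fun α => |x α| ⊓ e) (0 : X) := by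
  constructor
  · intro h
    simpa only [sub_zero] using h e he.le
  · rintro ⟨A, hne, -, hA, hdom⟩ u hu
    have hnonneg : ∀ α, 0 ≤ |x α| ⊓ u := fun α => le_inf (abs_nonneg _) hu
    refine ⟨{b | ∃ α₀, ∀ α, α₀ ≤ α → |x α| ⊓ u ≤ b}, ?_, ?_, ⟨?_, ?_⟩, ?_⟩
    · exact ⟨u, Classical.arbitrary ι, fun α _ => inf_le_right⟩
    · rintro b ⟨β, hβ⟩ c ⟨γ, hγ⟩
      obtain ⟨δ, hβδ, hγδ⟩ := exists_ge_ge β γ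
      exact ⟨b ⊓ c, ⟨δ, fun α hα =>
        le_inf (hβ α (hβδ.trans hα)) (hγ α (hγδ.trans hα))⟩, inf_le_left, inf_le_right⟩
    · rintro b ⟨β, hβ⟩
      exact (hnonneg β).trans (hβ β le_rfl)
    · intro z hz
      have hz_le : ∀ n : ℕ, ∀ a ∈ A, z ⊔ 0 ≤ n • a + (u - u ⊓ n • e) := by
        intro n a ha
        obtain ⟨α₀, hα₀⟩ := hdom a ha
        have hr : 0 ≤ u - u ⊓ n • e := sub_nonneg.2 inf_le_left
        have hbound : ∀ α, α₀ ≤ α → |x α| ⊓ u ≤ n • a + (u - u ⊓ n • e) := by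
          intro α hα
          have hxa : |x α| ⊓ e ≤ a := by
            simpa only [sub_zero, abs_of_nonneg (le_inf (abs_nonneg (x α)) he.le)] using hα₀ α hα
          have hu_le : u ≤ n • e + (u - u ⊓ n • e) := by
            calc u = u ⊓ n • e + (u - u ⊓ n • e) := by abel
              _ ≤ n • e + (u - u ⊓ n • e) := by gcongr; exact inf_le_right
          calc |x α| ⊓ u ≤ |x α| ⊓ (n • e + (u - u ⊓ n • e)) := inf_le_inf_left _ hu_le
            _ ≤ |x α| ⊓ n • e + |x α| ⊓ (u - u ⊓ n • e) :=
              inf_add_le_inf_add_inf (abs_nonneg _) (nsmul_nonneg he.le n) hr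
            _ ≤ n • a + (u - u ⊓ n • e) :=
              add_le_add ((inf_nsmul_le_nsmul_inf (abs_nonneg _) he.le n).trans
                (nsmul_le_nsmul_right hxa n)) inf_le_right
        exact sup_le (hz ⟨α₀, hbound⟩) ((hnonneg α₀).trans (hbound α₀ le_rfl))
      have hsum : ∀ n : ℕ, z ⊔ 0 + u ⊓ n • e ≤ u := fun n =>
        le_sub_iff_add_le.1 (le_of_forall_le_nsmul_add hA hne n (hz_le n))
      have hinf : (z ⊔ 0) ⊓ e = 0 :=
        le_antisymm (hArch _ u (nsmul_inf_le_of_add_inf_nsmul_le hu hsum))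
          (le_inf le_sup_right he.le)
      exact le_sup_left.trans (hweak _ le_sup_right hinf).le
    · rintro b ⟨β, hβ⟩
      refine ⟨β, fun α hα => ?_⟩
      simpa only [sub_zero, abs_of_nonneg (hnonneg α)] using hβ α hα
end

section
/- Every disjoint sequence (x_n) in an Archimedean vector lattice X uo-converges to 0 in X. -/
open Filter Finset

universe u v

/-- In an Archimedean lattice ordered group, an element `d` that lies below every eventual
upper bound of a sequence bounded above, and is eventually disjoint from the sequence, is nonpositive. -/
theorem nonpos_of_le_eventual_upperBounds
    {X : Type*} [Lattice X] [AddCommGroup X] [CovariantClass X X (· + ·) (· ≤ ·)]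
    (hArch : ∀ a b : X, (∀ n : ℕ, n • a ≤ b) → a ≤ 0)
    {y : ℕ → X} {u d : X} (hu : ∀ᶠ n in atTop, y n ≤ u)
    (hd : ∀ a, (∀ᶠ n in atTop, y n ≤ a) → d ≤ a)
    (hdy : ∀ᶠ n in atTop, d ⊓ y n = 0) : d ≤ 0 := by
  have hsub (a : X) (ha : ∀ᶠ n in atTop, y n ≤ a) : ∀ᶠ n in atTop, y n ≤ a - d := by
    filter_upwards [ha, hdy] with n hn hdn
    have hadd := inf_add_sup d (y n)
    rw [hdn, zero_add] at hadd
    rw [le_sub_iff_add_le', ← hadd]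
    exact sup_le (hd a ha) hn
  have hmul (m : ℕ) : ∀ a, (∀ᶠ n in atTop, y n ≤ a) → (m + 1) • d ≤ a := by
    induction m with
    | zero => simpa using hd
    | succ m ih =>
      intro a ha
      rw [succ_nsmul, ← le_sub_iff_add_le]
      exact ih _ (hsub a ha)
  refine hArch d (u - d) fun m => ?_
  rw [le_sub_iff_add_le, ← succ_nsmul]
  exact hmul m u hu

/-- Every disjoint sequence in an Archimedean vector lattice uo-converges
to `0`. -/
theorem disjoint_seq_uoConv_zero
    {X : Type u} [Lattice X] [AddCommGroup X] [Module ℝ X]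
    [CovariantClass X X (· + ·) (· ≤ ·)] [PosSMulMono ℝ X]
    (hArch : ∀ a b : X, (∀ n : ℕ, n • a ≤ b) → a ≤ 0)
    (x : ℕ → X) (hdisj : ∀ n m : ℕ, n ≠ m → |x n| ⊓ |x m| = 0) :
    UoConv x 0 := by
  intro u hu
  set y : ℕ → X := fun n => |x n - 0| ⊓ u with hy
  have hy0 (n : ℕ) : 0 ≤ y n := le_inf (abs_nonneg _) hu
  have hyu : ∀ᶠ n in atTop, y n ≤ u := Eventually.of_forall fun n => inf_le_right
  have hydisj (k n : ℕ) (hkn : k ≠ n) : y k ⊓ y n = 0 := by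
    refine le_antisymm ?_ (le_inf (hy0 k) (hy0 n))
    rw [← hdisj k n hkn]
    simpa [hy] using inf_le_inf (inf_le_left (a := |x k|) (b := u))
      (inf_le_left (a := |x n|) (b := u))
  refine ⟨{a | ∀ᶠ n in atTop, y n ≤ a}, ⟨u, hyu⟩, ?_, ⟨?_, ?_⟩, ?_⟩
  · intro a ha b hb
    exact ⟨a ⊓ b, (ha.and hb).mono fun n hn => le_inf hn.1 hn.2, inf_le_left, inf_le_right⟩
  · intro a ha
    obtain ⟨n, hn⟩ := Eventually.exists ha
    exact (hy0 n).trans hn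
  · intro b hb
    have hc : ∀ a, (∀ᶠ n in atTop, y n ≤ a) → b ⊔ 0 ≤ a := fun a ha => by
      obtain ⟨n, hn⟩ := ha.exists
      exact sup_le (hb ha) ((hy0 n).trans hn)
    have hcy (k : ℕ) : (b ⊔ 0) ⊓ y k = 0 := by
      refine le_antisymm ?_ (le_inf le_sup_right (hy0 k))
      refine nonpos_of_le_eventual_upperBounds hArch hyu
        (fun a ha => inf_le_left.trans (hc a ha)) ?_
      filter_upwards [eventually_gt_atTop k] with n hn
      rw [inf_assoc, hydisj k n hn.ne]
      exact inf_eq_right.2 le_sup_right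
    exact le_sup_left.trans
      (nonpos_of_le_eventual_upperBounds hArch hyu hc (Eventually.of_forall hcy))
  · intro a ha
    obtain ⟨N, hN⟩ := eventually_atTop.1 ha
    refine ⟨N, fun n hn => ?_⟩
    rw [sub_zero, abs_of_nonneg (hy0 n)]
    exact hN n hn
end

section
/- Let X be a vector lattice that is σ-order complete and σ-laterally complete. Then a sequence (x_n) in X is uo-Cauchy if and only if it is order convergent (to some element of X). -/
open Filter Finset

universe u v

section DisjointElements

variable {X : Type*} [Lattice X] [AddCommGroup X]

theorem posPart_le_iff {a b : X} : a⁺ ≤ b ↔ a ≤ b ∧ 0 ≤ b := sup_le_iff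

theorem inf_eq_zero_mono {a b a' b' : X} (h : a ⊓ b = 0) (ha : a' ≤ a) (hb : b' ≤ b)
    (ha0 : 0 ≤ a') (hb0 : 0 ≤ b') : a' ⊓ b' = 0 :=
  le_antisymm ((inf_le_inf ha hb).trans h.le) (le_inf ha0 hb0)

theorem eq_zero_of_inf_eq_zero_of_le {a b : X} (h : a ⊓ b = 0) (hab : a ≤ b) : a = 0 := by
  rwa [inf_eq_left.2 hab] at h

variable [IsOrderedAddMonoid X]

theorem add_le_of_inf_eq_zero {a b c : X} (h : a ⊓ b = 0) (ha : a ≤ c) (hb : b ≤ c) :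
    a + b ≤ c := by
  rw [← inf_add_sup a b, h, zero_add]
  exact sup_le ha hb

theorem inf_add_eq_zero {a b c : X} (hb : a ⊓ b = 0) (hc : a ⊓ c = 0) : a ⊓ (b + c) = 0 := by
  have ha0 : 0 ≤ a := hb ▸ inf_le_left
  have hb0 : 0 ≤ b := hb ▸ inf_le_right
  have hc0 : 0 ≤ c := hc ▸ inf_le_right
  refine le_antisymm ?_ (le_inf ha0 (add_nonneg hb0 hc0))
  have h : a ⊓ (b + c) ≤ b + a ⊓ c := by
    rw [add_inf]
    exact inf_le_inf (le_add_of_nonneg_left hb0) le_rfl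
  rw [hc, add_zero] at h
  exact (le_inf inf_le_left h).trans hb.le

theorem inf_nsmul_eq_zero {a b : X} (h : a ⊓ b = 0) (n : ℕ) : a ⊓ n • b = 0 := by
  induction n with
  | zero =>
    rw [zero_nsmul]
    exact inf_eq_right.2 (h ▸ inf_le_left)
  | succ n ih =>
    rw [succ_nsmul]
    exact inf_add_eq_zero ih h

/-- An element disjoint from every member of a set is disjoint from its supremum. -/
theorem IsLUB.inf_eq_zero {S : Set X} {q r : X} (hq : IsLUB S q) (hS : S.Nonempty)
    (hr : ∀ s ∈ S, r ⊓ s = 0) : r ⊓ q = 0 := by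
  obtain ⟨s, hs⟩ := hS
  have hr0 : 0 ≤ r := hr s hs ▸ inf_le_left
  have hs0 : 0 ≤ s := hr s hs ▸ inf_le_right
  have h0 : 0 ≤ r ⊓ q := le_inf hr0 (hs0.trans (hq.1 hs))
  refine le_antisymm ?_ h0
  have h : q ≤ q - r ⊓ q := by
    refine hq.2 fun t ht => le_sub_iff_add_le'.2 (add_le_of_inf_eq_zero ?_ inf_le_right (hq.1 ht))
    exact inf_eq_zero_mono (hr t ht) inf_le_left le_rfl h0 (hr t ht ▸ inf_le_right)
  simpa using h

theorem posPart_sub_inf_posPart_sub (a b : X) : (a - b)⁺ ⊓ (b - a)⁺ = 0 := by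
  have h := posPart_inf_negPart_eq_zero (a - b)
  rwa [← posPart_neg, neg_sub] at h

theorem posPart_add_le (a b : X) : (a + b)⁺ ≤ a⁺ + b⁺ :=
  posPart_le_iff.2 ⟨add_le_add (le_posPart a) (le_posPart b),
    add_nonneg (posPart_nonneg a) (posPart_nonneg b)⟩

end DisjointElements

section SigmaComplete

variable {X : Type*} [Lattice X] [AddCommGroup X] [IsOrderedAddMonoid X]

/-- The component `q` of `e` in the band generated by a sequence `z`. -/
theorem exists_component (hArch : ∀ a b : X, (∀ n : ℕ, n • a ≤ b) → a ≤ 0)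
    (hσoc : ∀ A : Set X, A.Countable → A.Nonempty → BddAbove A → ∃ l : X, IsLUB A l)
    (z : ℕ → X) (e : X) (hz : ∀ n, 0 ≤ z n) (he : 0 ≤ e) :
    ∃ q, 0 ≤ q ∧ q ≤ e ∧ (∀ n, (e - q) ⊓ z n = 0) ∧
      ∀ r, (∀ n, r ⊓ z n = 0) → r ⊓ q = 0 := by
  obtain ⟨q, hq⟩ := hσoc (Set.range fun p : ℕ × ℕ => p.2 • z p.1 ⊓ e)
    (Set.countable_range _) (Set.range_nonempty _)
    ⟨e, by rintro _ ⟨p, rfl⟩; exact inf_le_right⟩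
  have hle : ∀ n m : ℕ, m • z n ⊓ e ≤ q := fun n m => hq.1 ⟨(n, m), rfl⟩
  have hq0 : 0 ≤ q := (le_inf (nsmul_nonneg (hz 0) 0) he).trans (hle 0 0)
  have hqe : q ≤ e := hq.2 (by rintro _ ⟨p, rfl⟩; exact inf_le_right)
  refine ⟨q, hq0, hqe, fun n => ?_, fun r hr => ?_⟩
  · refine le_antisymm (hArch _ q fun m => ?_) (le_inf (sub_nonneg.2 hqe) (hz n))
    induction m with
    | zero => simpa using hq0
    | succ m ih =>
      refine le_trans (le_inf (nsmul_le_nsmul_right inf_le_right _) ?_) (hle n (m + 1))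
      rw [succ_nsmul]
      calc _ ≤ q + (e - q) := add_le_add ih inf_le_left
        _ = e := by abel
  · refine hq.inf_eq_zero (Set.range_nonempty _) ?_
    rintro _ ⟨p, rfl⟩
    have hr0 : 0 ≤ r := hr 0 ▸ inf_le_left
    exact inf_eq_zero_mono (inf_nsmul_eq_zero (hr p.1) p.2) le_rfl inf_le_left hr0
      (le_inf (nsmul_nonneg (hz _) _) he)

/-- Every sequence of positive vectors lies in a principal band. -/
theorem exists_weak_unit (hArch : ∀ a b : X, (∀ n : ℕ, n • a ≤ b) → a ≤ 0)
    (hσoc : ∀ A : Set X, A.Countable → A.Nonempty → BddAbove A → ∃ l : X, IsLUB A l)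
    (hσlat : ∀ d : ℕ → X, (∀ n, 0 ≤ d n) → (∀ n m : ℕ, n ≠ m → d n ⊓ d m = 0) →
      ∃ l : X, IsLUB (Set.range d) l)
    (y : ℕ → X) (hy : ∀ n, 0 ≤ y n) :
    ∃ e, 0 ≤ e ∧ ∀ n z, z ⊓ e = 0 → z ≤ y n → z = 0 := by
  have hdiff : ∀ a b : X, 0 ≤ a → 0 ≤ b → ∃ d, 0 ≤ d ∧ d ⊓ a = 0 ∧
      ∀ r, r ⊓ a = 0 → r ⊓ d = 0 → r ⊓ b = 0 := by
    intro a b ha hb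
    obtain ⟨q, -, hqb, hqa, hr⟩ := exists_component hArch hσoc (fun _ => a) b (fun _ => ha) hb
    refine ⟨b - q, sub_nonneg.2 hqb, hqa 0, fun r hra hrd => ?_⟩
    have h := inf_add_eq_zero (hr r fun _ => hra) hrd
    rwa [add_sub_cancel] at h
  choose! f hf0 hfa hfb using hdiff
  let s : ℕ → X := fun n => Nat.rec 0 (fun k a => a + f a (y k)) n
  have hs_succ : ∀ n, s (n + 1) = s n + f (s n) (y n) := fun _ => rfl
  have hs0 : ∀ n, 0 ≤ s n := by
    intro n
    induction n with
    | zero => exact le_rfl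
    | succ n ih => exact hs_succ n ▸ add_nonneg ih (hf0 _ _ ih (hy n))
  have hd0 : ∀ n, 0 ≤ f (s n) (y n) := fun n => hf0 _ _ (hs0 n) (hy n)
  have hs_mono : Monotone s := monotone_nat_of_le_succ fun n =>
    hs_succ n ▸ le_add_of_nonneg_right (hd0 n)
  have hlt : ∀ m n, m < n → f (s n) (y n) ⊓ f (s m) (y m) = 0 := by
    intro m n hmn
    refine inf_eq_zero_mono (hfa _ _ (hs0 n) (hy n)) le_rfl ?_ (hd0 n) (hd0 m)
    refine le_trans ?_ (hs_mono (Nat.succ_le_of_lt hmn))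
    exact hs_succ m ▸ le_add_of_nonneg_left (hs0 m)
  obtain ⟨e, he⟩ := hσlat (fun n => f (s n) (y n)) hd0 fun n m hnm => by
    rcases lt_or_gt_of_ne hnm with h | h
    · rw [inf_comm]; exact hlt n m h
    · exact hlt m n h
  have hde : ∀ n, f (s n) (y n) ≤ e := fun n => he.1 ⟨n, rfl⟩
  refine ⟨e, (hd0 0).trans (hde 0), fun n z hze hzy => ?_⟩
  have hz0 : 0 ≤ z := hze ▸ inf_le_left
  have hzd : ∀ k, z ⊓ f (s k) (y k) = 0 := fun k =>
    inf_eq_zero_mono hze le_rfl (hde k) hz0 (hd0 k)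
  have hzs : ∀ k, z ⊓ s k = 0 := by
    intro k
    induction k with
    | zero => exact inf_eq_right.2 hz0
    | succ k ih => exact hs_succ k ▸ inf_add_eq_zero ih (hzd k)
  exact eq_zero_of_inf_eq_zero_of_le (hfb _ _ (hs0 n) (hy n) z (hzs n) (hzd n)) hzy

/-- A positive sequence in the band of `e` is bounded if the components `q k` of `e` in the bands
generated by the vectors `(y n - k • e)⁺` have infimum `0`. -/
theorem bddAbove_range_of_components
    (hσlat : ∀ d : ℕ → X, (∀ n, 0 ≤ d n) → (∀ n m : ℕ, n ≠ m → d n ⊓ d m = 0) →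
      ∃ l : X, IsLUB (Set.range d) l)
    {y : ℕ → X} (hy : ∀ n, 0 ≤ y n) {e : X} (he : 0 ≤ e)
    (hunit : ∀ n z, z ⊓ e = 0 → z ≤ y n → z = 0) {q : ℕ → X} (hq0 : ∀ k, 0 ≤ q k)
    (hqe : ∀ k, q k ≤ e) (hqd : ∀ k n, (e - q k) ⊓ (y n - k • e)⁺ = 0)
    (hqr : ∀ k r, (∀ n, r ⊓ (y n - k • e)⁺ = 0) → r ⊓ q k = 0)
    (hinf : ∀ v, (∀ k, v ≤ q k) → v ≤ 0) : BddAbove (Set.range y) := by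
  have hqc : ∀ k, (e - q k) ⊓ q k = 0 := fun k => hqr k _ (hqd k)
  have hanti : Antitone q := by
    refine antitone_nat_of_succ_le fun k => ?_
    have h : (e - q k) ⊓ q (k + 1) = 0 := hqr (k + 1) _ fun n => by
      refine inf_eq_zero_mono (hqd k n) le_rfl (posPart_mono (sub_le_sub_left ?_ _))
        (sub_nonneg.2 (hqe k)) (posPart_nonneg _)
      exact nsmul_le_nsmul_left he (Nat.le_succ k)
    have h' := add_le_of_inf_eq_zero h (sub_le_self _ (hq0 k)) (hqe (k + 1))
    rwa [sub_add_eq_add_sub, sub_le_iff_le_add, add_le_add_iff_left] at h'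
  have hc0 : ∀ k, 0 ≤ q k - q (k + 1) := fun k => sub_nonneg.2 (hanti (Nat.le_succ k))
  have hcq : ∀ k, q k - q (k + 1) ≤ q k := fun k => sub_le_self _ (hq0 _)
  have hce : ∀ k, q k - q (k + 1) ≤ e - q (k + 1) := fun k => sub_le_sub_right (hqe k) _
  have hlt : ∀ j k, j < k → (q j - q (j + 1)) ⊓ (q k - q (k + 1)) = 0 := fun j k hjk =>
    inf_eq_zero_mono (hqc (j + 1)) (hce j) ((hcq k).trans (hanti hjk)) (hc0 j) (hc0 k)
  have hlt' : ∀ j k, j < k →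
      (j + 1) • (q j - q (j + 1)) ⊓ (k + 1) • (q k - q (k + 1)) = 0 := by
    intro j k hjk
    refine inf_nsmul_eq_zero ?_ _
    rw [inf_comm]
    refine inf_nsmul_eq_zero ?_ _
    rw [inf_comm]
    exact hlt j k hjk
  obtain ⟨D, hD⟩ := hσlat (fun k => (k + 1) • (q k - q (k + 1)))
    (fun k => nsmul_nonneg (hc0 k) _) fun n m hnm => by
      rcases lt_or_gt_of_ne hnm with h | h
      · exact hlt' n m h
      · rw [inf_comm]; exact hlt' m n h
  have hdD : ∀ k, (k + 1) • (q k - q (k + 1)) ≤ D := fun k => hD.1 ⟨k, rfl⟩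
  have hD0 : 0 ≤ D := (nsmul_nonneg (hc0 0) _).trans (hdD 0)
  refine ⟨D, ?_⟩
  rintro _ ⟨n, rfl⟩
  have hz0 : 0 ≤ (y n - D)⁺ := posPart_nonneg _
  have hzy : (y n - D)⁺ ≤ y n := posPart_le_iff.2 ⟨sub_le_self _ hD0, hy n⟩
  have hzc : ∀ k, (y n - D)⁺ ⊓ (q k - q (k + 1)) = 0 := by
    intro k
    set c := q k - q (k + 1) with hc
    set w := (y n - D)⁺ ⊓ c with hw
    have hw0 : 0 ≤ w := le_inf hz0 (hc0 k)
    have hwc : w ≤ c := inf_le_right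
    have hsub : 0 ≤ e - q (k + 1) := sub_nonneg.2 (hqe _)
    have h1 : w ⊓ (y n - (k + 1) • e)⁺ = 0 :=
      inf_eq_zero_mono (hqd (k + 1) n) (hwc.trans (hce k)) le_rfl hw0 (posPart_nonneg _)
    have h2 : w ⊓ ((e - q k) + q (k + 1)) = 0 := by
      refine inf_add_eq_zero ?_ (inf_eq_zero_mono (hqc (k + 1)) (hwc.trans (hce k)) le_rfl hw0
        (hq0 _))
      rw [inf_comm]
      exact inf_eq_zero_mono (hqc k) le_rfl (hwc.trans (hcq k)) (sub_nonneg.2 (hqe k)) hw0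
    refine eq_zero_of_inf_eq_zero_of_le (inf_add_eq_zero h1 (inf_nsmul_eq_zero h2 (k + 1))) ?_
    have h3 : 0 ≤ (k + 1) • ((e - q k) + q (k + 1)) :=
      nsmul_nonneg (add_nonneg (sub_nonneg.2 (hqe k)) (hq0 _)) _
    calc w ≤ (y n - D)⁺ := inf_le_left
      _ ≤ (y n - (k + 1) • c)⁺ := posPart_mono (sub_le_sub_left (hdD k) _)
      _ = ((y n - (k + 1) • e) + (k + 1) • ((e - q k) + q (k + 1)))⁺ := by
        congr 1
        rw [hc, show q k - q (k + 1) = e - ((e - q k) + q (k + 1)) by abel, nsmul_sub]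
        abel
      _ ≤ _ := (posPart_add_le _ _).trans_eq (by rw [posPart_of_nonneg h3])
  have hzq : ∀ k, (y n - D)⁺ ⊓ (e - q k) = 0 := by
    intro k
    induction k with
    | zero =>
      have h := hqd 0 n
      rw [zero_nsmul, sub_zero, posPart_of_nonneg (hy n), inf_comm] at h
      exact inf_eq_zero_mono h hzy le_rfl hz0 (sub_nonneg.2 (hqe 0))
    | succ k ih =>
      have h := inf_add_eq_zero ih (hzc k)
      rwa [sub_add_sub_cancel] at h
  have hze : (y n - D)⁺ ⊓ e = 0 := by
    refine le_antisymm (hinf _ fun k => ?_) (le_inf hz0 he)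
    have h : (y n - D)⁺ ⊓ e ⊓ (e - q k) = 0 := inf_eq_zero_mono (hzq k) inf_le_left le_rfl
      (le_inf hz0 he) (sub_nonneg.2 (hqe k))
    have h' := add_le_of_inf_eq_zero h inf_le_right (sub_le_self _ (hq0 k))
    rwa [add_sub_left_comm, add_le_iff_nonpos_right, sub_nonpos] at h'
  exact sub_nonpos.1 (posPart_eq_zero.1 (hunit n _ hze hzy))

/-- For a uo-Cauchy sequence, the components of `e` in the bands generated by the vectors
`(|x n| - k • e)⁺` have infimum `0`. -/
theorem UoCauchy.component_inf_le_zero (hArch : ∀ a b : X, (∀ n : ℕ, n • a ≤ b) → a ≤ 0)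
    {x : ℕ → X} (hx : UoCauchy x) {e : X} (he : 0 ≤ e) {q : ℕ → X} (hq0 : ∀ k, 0 ≤ q k)
    (hqe : ∀ k, q k ≤ e)
    (hqr : ∀ k r, (∀ n, r ⊓ (|x n| - k • e)⁺ = 0) → r ⊓ q k = 0)
    {v : X} (hv : ∀ k, v ≤ q k) : v ≤ 0 := by
  obtain ⟨A, -, -, hA, hAx⟩ := hx e he
  suffices h : ∀ a ∈ A, v⁺ ≤ a from (le_posPart v).trans (hA.2 h)
  intro a ha
  have ha0 : 0 ≤ a := hA.1 ha
  have hvq : ∀ k, v⁺ ≤ q k := fun k => posPart_le_iff.2 ⟨hv k, hq0 k⟩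
  have hve : v⁺ ≤ e := (hvq 0).trans (hqe 0)
  obtain ⟨⟨N₁, N₂⟩, hN⟩ := hAx a ha
  set N := max N₁ N₂
  have hpa : ∀ n, N ≤ n → |x n - x N| ⊓ e ≤ a := by
    intro n hn
    have h := hN (n, N) ⟨(le_max_left _ _).trans hn, le_max_right _ _⟩
    simp only [sub_zero] at h
    exact (le_abs_self _).trans h
  have hpc : ∀ n, N ≤ n → (e - a)⁺ ⊓ (|x n - x N| - e)⁺ = 0 := by
    intro n hn
    refine inf_eq_zero_mono (posPart_sub_inf_posPart_sub e |x n - x N|) ?_ le_rfl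
      (posPart_nonneg _) (posPart_nonneg _)
    refine posPart_le_iff.2 ⟨?_, posPart_nonneg _⟩
    have h := hpa n hn
    rw [sub_le_comm]
    refine le_trans (le_inf ?_ ?_) h
    · rw [sub_le_comm]; exact le_posPart _
    · exact sub_le_self _ (posPart_nonneg _)
  set y := ∑ i ∈ Finset.range (N + 1), |x i| with hy
  have hxy : ∀ n ≤ N, |x n| ≤ y := fun n hn =>
    Finset.single_le_sum (f := fun i => |x i|) (fun i _ => abs_nonneg _)
      (Finset.mem_range.2 (Nat.lt_succ_of_le hn))
  have hy0 : 0 ≤ y := (abs_nonneg _).trans (hxy 0 (Nat.zero_le _))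
  set r := v⁺ ⊓ (e - a)⁺ with hr
  have hr0 : 0 ≤ r := le_inf (posPart_nonneg _) (posPart_nonneg _)
  have hre : r ≤ e := inf_le_left.trans hve
  have hrj : ∀ j : ℕ, (j • e - y)⁺ ⊓ r = 0 := by
    intro j
    set g := (j • e - y)⁺ ⊓ (e - a)⁺ with hg
    have hg0 : 0 ≤ g := le_inf (posPart_nonneg _) (posPart_nonneg _)
    have hg1 : g ⊓ (y - j • e)⁺ = 0 := inf_eq_zero_mono (posPart_sub_inf_posPart_sub (j • e) y)
      inf_le_left le_rfl hg0 (posPart_nonneg _)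
    have hgq : g ⊓ q (j + 1) = 0 := by
      refine hqr _ _ fun n => ?_
      rcases le_total n N with hn | hn
      · refine inf_eq_zero_mono hg1 le_rfl (posPart_mono (sub_le_sub (hxy n hn) ?_)) hg0
          (posPart_nonneg _)
        exact nsmul_le_nsmul_left he (Nat.le_succ j)
      · have hg2 : g ⊓ (|x n - x N| - e)⁺ = 0 :=
          inf_eq_zero_mono (hpc n hn) inf_le_right le_rfl hg0 (posPart_nonneg _)
        refine inf_eq_zero_mono (inf_add_eq_zero hg1 hg2) le_rfl ?_ hg0 (posPart_nonneg _)
        refine le_trans (posPart_mono ?_) (posPart_add_le _ _)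
        have h : |x n| ≤ y + |x n - x N| := by
          calc |x n| = |x N + (x n - x N)| := by rw [add_sub_cancel]
            _ ≤ |x N| + |x n - x N| := abs_add_le _ _
            _ ≤ _ := add_le_add_left (hxy N le_rfl) _
        calc |x n| - (j + 1) • e ≤ y + |x n - x N| - (j + 1) • e := sub_le_sub_right h _
          _ = _ := by rw [succ_nsmul]; abel
    refine le_antisymm ?_ (le_inf (posPart_nonneg _) hr0)
    refine le_trans (le_inf (le_inf inf_le_left ?_) ?_) hgq.le
    · exact inf_le_right.trans inf_le_right
    · exact inf_le_right.trans (inf_le_left.trans (hvq _))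
  have hr_zero : r = 0 := by
    refine le_antisymm (hArch r y fun j => ?_) hr0
    have h := add_le_of_inf_eq_zero (inf_nsmul_eq_zero (hrj j) j)
      (posPart_le_iff.2 ⟨sub_le_self _ hy0, nsmul_nonneg he j⟩) (nsmul_le_nsmul_right hre j)
    have h' := (add_le_add_left (le_posPart (j • e - y)) _).trans h
    rwa [sub_add_eq_add_sub, sub_le_iff_le_add, add_le_add_iff_left] at h'
  have h := add_le_of_inf_eq_zero hr_zero hve
    (posPart_le_iff.2 ⟨sub_le_self _ ha0, he⟩)
  have h' := (add_le_add_right (le_posPart (e - a)) _).trans h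
  rwa [add_sub_left_comm, add_le_iff_nonpos_right, sub_nonpos] at h'

theorem UoCauchy.bddAbove_range_abs (hArch : ∀ a b : X, (∀ n : ℕ, n • a ≤ b) → a ≤ 0)
    (hσoc : ∀ A : Set X, A.Countable → A.Nonempty → BddAbove A → ∃ l : X, IsLUB A l)
    (hσlat : ∀ d : ℕ → X, (∀ n, 0 ≤ d n) → (∀ n m : ℕ, n ≠ m → d n ⊓ d m = 0) →
      ∃ l : X, IsLUB (Set.range d) l)
    {x : ℕ → X} (hx : UoCauchy x) : BddAbove (Set.range fun n => |x n|) := by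
  obtain ⟨e, he, hunit⟩ := exists_weak_unit hArch hσoc hσlat (fun n => |x n|)
    fun n => abs_nonneg _
  choose q hq0 hqe hqd hqr using fun k : ℕ => exists_component hArch hσoc
    (fun n => (|x n| - k • e)⁺) e (fun n => posPart_nonneg _) he
  exact bddAbove_range_of_components hσlat (fun n => abs_nonneg _) he hunit hq0 hqe hqd hqr
    fun v hv => hx.component_inf_le_zero hArch he hq0 hqe hqr hv

theorem UoCauchy.oCauchy_of_bddAbove {x : ℕ → X} (hx : UoCauchy x)
    (hb : BddAbove (Set.range fun n => |x n|)) : OCauchy x := by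
  obtain ⟨D, hD⟩ := hb
  have hxD : ∀ n, |x n| ≤ D := fun n => hD ⟨n, rfl⟩
  have hD0 : 0 ≤ D := (abs_nonneg _).trans (hxD 0)
  obtain ⟨A, hne, hdir, hA, hAx⟩ := hx (D + D) (add_nonneg hD0 hD0)
  refine ⟨A, hne, hdir, hA, fun a ha => ?_⟩
  obtain ⟨p₀, hp⟩ := hAx a ha
  refine ⟨p₀, fun p hpp => le_trans ?_ (hp p hpp)⟩
  have h : |x p.1 - x p.2| ≤ D + D := by
    rw [sub_eq_add_neg]
    refine (abs_add_le _ _).trans ?_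
    rw [abs_neg]
    exact add_le_add (hxD _) (hxD _)
  simp only [sub_zero]
  rw [inf_eq_left.2 h]
  exact le_abs_self _

/-- In a σ-order complete lattice-ordered group, bounded order Cauchy sequences order converge. -/
theorem OCauchy.exists_oConv
    (hσoc : ∀ A : Set X, A.Countable → A.Nonempty → BddAbove A → ∃ l : X, IsLUB A l)
    {x : ℕ → X} (hx : OCauchy x) (hb : BddAbove (Set.range fun n => |x n|)) :
    ∃ l : X, OConv x l := by
  obtain ⟨D, hD⟩ := hb
  have hxD : ∀ n, |x n| ≤ D := fun n => hD ⟨n, rfl⟩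
  have hinf : ∀ n : ℕ, ∃ i : X, IsGLB (x '' Set.Ici n) i := by
    intro n
    obtain ⟨i, hi⟩ := hσoc ((fun m => -x m) '' Set.Ici n) (Set.to_countable _ |>.image _)
      (Set.nonempty_Ici.image _)
      ⟨D, by rintro _ ⟨m, -, rfl⟩; exact (neg_le_abs _).trans (hxD m)⟩
    refine ⟨-i, ?_, fun b hb => ?_⟩
    · rintro _ ⟨m, hm, rfl⟩
      exact neg_le.1 (hi.1 ⟨m, hm, rfl⟩)
    · refine le_neg.1 (hi.2 ?_)
      rintro _ ⟨m, hm, rfl⟩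
      exact neg_le_neg (hb ⟨m, hm, rfl⟩)
  choose i hi using hinf
  have hix : ∀ n m, n ≤ m → i n ≤ x m := fun n m hnm => (hi n).1 ⟨m, hnm, rfl⟩
  obtain ⟨l, hl⟩ := hσoc (Set.range i) (Set.countable_range _) (Set.range_nonempty _)
    ⟨D, by
      rintro _ ⟨n, rfl⟩
      exact (hix n n le_rfl).trans ((le_abs_self _).trans (hxD n))⟩
  obtain ⟨A, hne, hdir, hA, hAx⟩ := hx
  refine ⟨l, A, hne, hdir, hA, fun a ha => ?_⟩
  obtain ⟨⟨N₁, N₂⟩, hN⟩ := hAx a ha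
  have hxa : ∀ n m, max N₁ N₂ ≤ n → max N₁ N₂ ≤ m → x n - x m ≤ a := by
    intro n m hn hm
    have h := hN (n, m) ⟨(le_max_left _ _).trans hn, (le_max_right _ _).trans hm⟩
    rw [sub_zero] at h
    exact (le_abs_self _).trans h
  refine ⟨max N₁ N₂, fun n hn => abs_le'.2 ⟨?_, ?_⟩⟩
  · rw [sub_le_comm]
    refine le_trans ((hi (max N₁ N₂)).2 ?_) (hl.1 ⟨_, rfl⟩)
    rintro _ ⟨m, hm, rfl⟩
    exact sub_le_comm.1 (hxa n m hn hm)
  · rw [neg_sub, sub_le_iff_le_add]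
    refine hl.2 ?_
    rintro _ ⟨j, rfl⟩
    refine (hix j (max j n) (le_max_left _ _)).trans (sub_le_iff_le_add.1 (hxa _ _ ?_ hn))
    exact hn.trans (le_max_right _ _)

theorem OConv.uoCauchy {x : ℕ → X} {l : X} (hx : OConv x l) : UoCauchy x := by
  intro u hu
  obtain ⟨A, hne, hdir, hA, hAx⟩ := hx
  refine ⟨(fun a => a + a) '' A, hne.image _, ?_, ⟨?_, ?_⟩, ?_⟩
  · rintro _ ⟨a, ha, rfl⟩ _ ⟨b, hb, rfl⟩
    obtain ⟨c, hc, hca, hcb⟩ := hdir a ha b hb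
    exact ⟨c + c, ⟨c, hc, rfl⟩, add_le_add hca hca, add_le_add hcb hcb⟩
  · rintro _ ⟨a, ha, rfl⟩
    exact add_nonneg (hA.1 ha) (hA.1 ha)
  · intro b hb
    refine hA.2 fun a ha => sub_nonpos.1 (hA.2 fun a' ha' => ?_)
    obtain ⟨c, hc, hca, hca'⟩ := hdir a ha a' ha'
    rw [sub_le_iff_le_add']
    exact (hb ⟨c, hc, rfl⟩).trans (add_le_add hca hca')
  · rintro _ ⟨a, ha, rfl⟩
    obtain ⟨N, hN⟩ := hAx a ha
    refine ⟨(N, N), fun p hp => ?_⟩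
    simp only [sub_zero]
    rw [abs_of_nonneg (le_inf (abs_nonneg _) hu)]
    refine inf_le_left.trans ?_
    calc |x p.1 - x p.2| = |(x p.1 - l) + -(x p.2 - l)| := by congr 1; abel
      _ ≤ |x p.1 - l| + |x p.2 - l| := (abs_add_le _ _).trans_eq (by rw [abs_neg])
      _ ≤ a + a := add_le_add (hN _ hp.1) (hN _ hp.2)

end SigmaComplete

/-- In a σ-order complete and σ-laterally complete (Archimedean) vector
lattice, a sequence is uo-Cauchy iff it is order convergent. -/
theorem uoCauchy_iff_oConv_of_sigmaComplete
    {X : Type u} [Lattice X] [AddCommGroup X] [Module ℝ X]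
    [CovariantClass X X (· + ·) (· ≤ ·)] [PosSMulMono ℝ X]
    (hArch : ∀ a b : X, (∀ n : ℕ, n • a ≤ b) → a ≤ 0)
    (hσoc : ∀ A : Set X, A.Countable → A.Nonempty → BddAbove A → ∃ l : X, IsLUB A l)
    (hσlat : ∀ d : ℕ → X, (∀ n, 0 ≤ d n) → (∀ n m : ℕ, n ≠ m → d n ⊓ d m = 0) →
      ∃ l : X, IsLUB (Set.range d) l)
    (x : ℕ → X) :
    UoCauchy x ↔ ∃ l : X, OConv x l := by
  have : IsOrderedAddMonoid X := { add_le_add_left := fun _ _ h c => add_le_add_left h c }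
  refine ⟨fun hx => ?_, fun ⟨_, hl⟩ => hl.uoCauchy⟩
  have hb := hx.bddAbove_range_abs hArch hσoc hσlat
  exact (hx.oCauchy_of_bddAbove hb).exists_oConv hσoc hb
end

section
/- Let X be a σ-order complete vector lattice and (x_n) a sequence in X with x_n →o 0. Then the Cesàro means a_n = (1/n)(x_1 + ⋯ + x_n) order converge to 0 in X. -/
open Filter Finset

universe u v

theorem cesaro_neg {X : Type*} [AddCommGroup X] [Module ℝ X] (x : ℕ → X) (n : ℕ) :
    cesaro (fun i => -x i) n = -cesaro x n := by
  simp [cesaro]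

theorem le_zero_of_forall_le_inv_smul {X : Type*} [Lattice X] [AddCommGroup X] [Module ℝ X]
    [PosSMulMono ℝ X] (hArch : ∀ a b : X, (∀ n : ℕ, n • a ≤ b) → a ≤ 0)
    {u y : X} (hu : 0 ≤ u) (hy : ∀ k : ℕ, y ≤ ((k + 1 : ℝ))⁻¹ • u) : y ≤ 0 := by
  refine hArch y u fun n => ?_
  cases n with
  | zero => simpa using hu
  | succ k =>
    have hpos : (0 : ℝ) < k + 1 := by positivity
    have := smul_le_smul_of_nonneg_left (hy k) hpos.le
    rwa [smul_inv_smul₀ hpos.ne', ← Nat.cast_add_one, Nat.cast_smul_eq_nsmul] at this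

section Cesaro

variable {X : Type*} [Lattice X] [AddCommGroup X] [IsOrderedAddMonoid X]

/-- A sequence that is eventually dominated in absolute value is order bounded. -/
theorem exists_forall_abs_le_of_eventually_abs_le {x : ℕ → X} {a : X} (ha : 0 ≤ a) {N : ℕ}
    (hN : ∀ n, N ≤ n → |x n| ≤ a) : ∃ u : X, 0 ≤ u ∧ ∀ n, |x n| ≤ u := by
  have hs : 0 ≤ ∑ i ∈ range N, |x i| := sum_nonneg fun i _ => abs_nonneg (x i)
  refine ⟨a + ∑ i ∈ range N, |x i|, add_nonneg ha hs, fun n => ?_⟩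
  rcases le_or_gt N n with hn | hn
  · exact (hN n hn).trans (le_add_of_nonneg_right hs)
  · exact (single_le_sum (f := fun i => |x i|) (fun i _ => abs_nonneg (x i))
      (mem_range.mpr hn)).trans (le_add_of_nonneg_left ha)

/-- Partial sums of a sequence bounded by `u`, and by `a` from the index `N` on. -/
theorem sum_range_le_nsmul_add_nsmul {y : ℕ → X} {u a : X} (hu : 0 ≤ u) (ha : 0 ≤ a) {N : ℕ}
    (hyu : ∀ n, y n ≤ u) (hya : ∀ n, N ≤ n → y n ≤ a) (n : ℕ) :
    ∑ i ∈ range n, y i ≤ N • u + n • a := by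
  rcases le_total n N with hn | hn
  · calc ∑ i ∈ range n, y i ≤ n • u := by
          simpa using sum_le_card_nsmul (range n) y u fun i _ => hyu i
      _ ≤ N • u := nsmul_le_nsmul_left hu hn
      _ ≤ N • u + n • a := le_add_of_nonneg_right (nsmul_nonneg ha n)
  · induction n, hn using Nat.le_induction with
    | base =>
      calc ∑ i ∈ range N, y i ≤ N • u := by
            simpa using sum_le_card_nsmul (range N) y u fun i _ => hyu i
        _ ≤ N • u + N • a := le_add_of_nonneg_right (nsmul_nonneg ha N)
    | succ n hn ih =>
      rw [sum_range_succ, succ_nsmul, ← add_assoc]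
      exact add_le_add ih (hya n hn)

variable [Module ℝ X] [PosSMulMono ℝ X]

theorem cesaro_le_add_smul {y : ℕ → X} {u a : X} (hu : 0 ≤ u) (ha : 0 ≤ a) {N : ℕ}
    (hyu : ∀ n, y n ≤ u) (hya : ∀ n, N ≤ n → y n ≤ a) {k n : ℕ} (hn : (k + 1) * N ≤ n) :
    cesaro y n ≤ a + ((k + 1 : ℝ))⁻¹ • u := by
  have hpos : (0 : ℝ) < n + 1 := by positivity
  have hcoef : 0 ≤ ((k + 1 : ℝ))⁻¹ - (n + 1 : ℝ)⁻¹ * N := by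
    have hn' : ((k + 1 : ℝ)) * N ≤ n := by exact_mod_cast hn
    rw [sub_nonneg, inv_mul_le_iff₀ hpos, ← div_eq_mul_inv, le_div_iff₀ (by positivity)]
    linarith
  calc cesaro y n ≤ (n + 1 : ℝ)⁻¹ • (N • u + (n + 1) • a) :=
        smul_le_smul_of_nonneg_left (sum_range_le_nsmul_add_nsmul hu ha hyu hya (n + 1))
          (inv_nonneg.mpr hpos.le)
    _ = a + ((n + 1 : ℝ)⁻¹ * N) • u := by
        rw [← Nat.cast_smul_eq_nsmul ℝ N, ← Nat.cast_smul_eq_nsmul ℝ (n + 1), smul_add,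
          smul_smul, smul_smul, Nat.cast_add_one, inv_mul_cancel₀ hpos.ne', one_smul, add_comm]
    _ ≤ a + ((k + 1 : ℝ))⁻¹ • u := by
        refine add_le_add_right ?_ a
        rw [← sub_nonneg, ← sub_smul]
        exact smul_nonneg hcoef hu

theorem abs_cesaro_le_add_smul {x : ℕ → X} {u a : X} (hu : 0 ≤ u) (ha : 0 ≤ a) {N : ℕ}
    (hxu : ∀ n, |x n| ≤ u) (hxa : ∀ n, N ≤ n → |x n| ≤ a) {k n : ℕ} (hn : (k + 1) * N ≤ n) :
    |cesaro x n| ≤ a + ((k + 1 : ℝ))⁻¹ • u := by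
  refine abs_le'.mpr ⟨?_, ?_⟩
  · exact cesaro_le_add_smul hu ha (fun n => (le_abs_self _).trans (hxu n))
      (fun n h => (le_abs_self _).trans (hxa n h)) hn
  · rw [← cesaro_neg]
    exact cesaro_le_add_smul hu ha (fun n => (neg_le_abs _).trans (hxu n))
      (fun n h => (neg_le_abs _).trans (hxa n h)) hn

theorem inv_smul_anti {u : X} (hu : 0 ≤ u) {k l : ℕ} (hkl : k ≤ l) :
    ((l + 1 : ℝ))⁻¹ • u ≤ ((k + 1 : ℝ))⁻¹ • u := by
  rw [← sub_nonneg, ← sub_smul]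
  refine smul_nonneg (sub_nonneg.mpr ?_) hu
  gcongr

end Cesaro

/-- In a σ-order complete (Archimedean) vector lattice, if `x_n →o 0`
then the Cesàro means of `(x_n)` order converge to `0`. -/
theorem cesaro_oConv_of_oConv
    {X : Type u} [Lattice X] [AddCommGroup X] [Module ℝ X]
    [CovariantClass X X (· + ·) (· ≤ ·)] [PosSMulMono ℝ X]
    (hArch : ∀ a b : X, (∀ n : ℕ, n • a ≤ b) → a ≤ 0)
    (hσoc : ∀ A : Set X, A.Countable → A.Nonempty → BddAbove A → ∃ l : X, IsLUB A l)
    (x : ℕ → X) (h : OConv x 0) :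
    OConv (cesaro x) 0 := by
  have : IsOrderedAddMonoid X :=
    { add_le_add_left := fun a b hab c => by
        rw [add_comm a c, add_comm b c]
        exact CovariantClass.elim c hab }
  obtain ⟨A, ⟨a₀, ha₀⟩, hdir, hglb, hA⟩ := h
  simp only [sub_zero] at hA
  obtain ⟨N₀, hN₀⟩ := hA a₀ ha₀
  obtain ⟨u, hu, hxu⟩ := exists_forall_abs_le_of_eventually_abs_le (hglb.1 ha₀) hN₀
  refine ⟨{b | ∃ a ∈ A, ∃ k : ℕ, b = a + ((k + 1 : ℝ))⁻¹ • u}, ⟨_, a₀, ha₀, 0, rfl⟩,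
    ?_, ⟨?_, ?_⟩, ?_⟩
  · rintro _ ⟨a, ha, k, rfl⟩ _ ⟨b, hb, l, rfl⟩
    obtain ⟨c, hc, hca, hcb⟩ := hdir a ha b hb
    exact ⟨_, ⟨c, hc, max k l, rfl⟩, add_le_add hca (inv_smul_anti hu (le_max_left k l)),
      add_le_add hcb (inv_smul_anti hu (le_max_right k l))⟩
  · rintro _ ⟨a, ha, k, rfl⟩
    exact add_nonneg (hglb.1 ha) (smul_nonneg (by positivity) hu)
  · intro y hy
    refine le_zero_of_forall_le_inv_smul hArch hu fun k => ?_
    rw [← sub_nonpos]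
    exact hglb.2 fun a ha => sub_le_iff_le_add.mpr (hy ⟨a, ha, k, rfl⟩)
  · rintro _ ⟨a, ha, k, rfl⟩
    obtain ⟨N, hN⟩ := hA a ha
    refine ⟨(k + 1) * N, fun n hn => ?_⟩
    rw [sub_zero]
    exact abs_cesaro_le_add_smul hu (hglb.1 ha) hxu hN hn
end

section
/- Let (x_n) be a sequence in an Archimedean vector lattice X. If (x_n) uo-converges to 0 in X, then its Cesàro means a_n = (1/n)(x_1 + ⋯ + x_n) uo-converge to 0 in X; if (x_n) is uo-Cauchy in X, then its Cesàro means are uo-Cauchy in X. -/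
open Filter Finset

universe u v

section Helpers

lemma cesaro_sub_const {X : Type*} [AddCommGroup X] [Module ℝ X] (x : ℕ → X) (c : X) (n : ℕ) :
    cesaro (fun i => x i - c) n = cesaro x n - c := by
  have hn : ((n + 1 : ℕ) : ℝ) ≠ 0 := by positivity
  unfold cesaro
  rw [Finset.sum_sub_distrib, smul_sub, Finset.sum_const, Finset.card_range,
    ← Nat.cast_smul_eq_nsmul ℝ, smul_smul, ← Nat.cast_succ, inv_mul_cancel₀ hn, one_smul]

variable {X : Type*} [Lattice X] [AddCommGroup X]

/-- A net `x` is locally null if every `w > 0` dominates some `p > 0` such that `|x α| ≤ w`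
eventually holds on the band generated by `p`. -/
def LocallyNull {ι : Type*} [Preorder ι] (x : ι → X) : Prop :=
  ∀ w : X, 0 < w → ∃ p : X, 0 < p ∧ p ≤ w ∧
    ∃ α₀, ∀ α, α₀ ≤ α → p ⊓ (|x α| - w)⁺ ≤ 0

lemma exists_pos_add_self [Module ℝ X] [PosSMulMono ℝ X] {w : X} (hw : 0 < w) : ∃ v : X, 0 < v ∧ v + v = w := by
  have hvv : (2⁻¹ : ℝ) • w + (2⁻¹ : ℝ) • w = w := by
    rw [← add_smul]; norm_num
  refine ⟨(2⁻¹ : ℝ) • w, lt_of_le_of_ne (smul_nonneg (by norm_num) hw.le) fun h0 => ?_, hvv⟩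
  rw [← h0, add_zero] at hvv
  exact hw.ne hvv

variable [CovariantClass X X (· + ·) (· ≤ ·)]

lemma posPart_sub_inf_posPart_sub_le (a b : X) : (a - b)⁺ ⊓ (b - a)⁺ ≤ 0 := by
  have h := posPart_inf_negPart_eq_zero (a - b)
  rw [← posPart_neg, neg_sub] at h
  exact h.le

lemma inf_add_le_zero {p a b : X} (hp : 0 ≤ p) (ha : 0 ≤ a) (hb : 0 ≤ b)
    (hpa : p ⊓ a ≤ 0) (hpb : p ⊓ b ≤ 0) : p ⊓ (a + b) ≤ 0 := by
  have h : p ⊓ (a + b) ≤ p ⊓ a + p ⊓ b := by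
    rw [inf_add, add_inf, add_inf]
    refine le_inf (le_inf ?_ ?_) (le_inf ?_ inf_le_right)
    · exact inf_le_left.trans (le_add_of_nonneg_left hp)
    · exact inf_le_left.trans (le_add_of_nonneg_right hb)
    · exact inf_le_left.trans (le_add_of_nonneg_left ha)
  exact h.trans (add_nonpos hpa hpb)

lemma inf_sum_le_zero {ι : Type*} {p : X} (hp : 0 ≤ p) (s : Finset ι) {f : ι → X}
    (hf : ∀ i ∈ s, 0 ≤ f i) (h : ∀ i ∈ s, p ⊓ f i ≤ 0) : p ⊓ ∑ i ∈ s, f i ≤ 0 := by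
  have : IsOrderedAddMonoid X :=
    ⟨fun _ _ h c => add_le_add_left h c, fun _ _ h c => add_le_add_right h c⟩
  classical
  induction s using Finset.induction_on with
  | empty => simp
  | insert i s hi ih =>
    rw [Finset.sum_insert hi]
    exact inf_add_le_zero hp (hf i (Finset.mem_insert_self i s))
      (Finset.sum_nonneg fun j hj => hf j (Finset.mem_insert_of_mem hj))
      (h i (Finset.mem_insert_self i s))
      (ih (fun j hj => hf j (Finset.mem_insert_of_mem hj)) fun j hj => h j (Finset.mem_insert_of_mem hj))

lemma nsmul_inf_le_zero {p a : X} (hp : 0 ≤ p) (ha : 0 ≤ a) (h : p ⊓ a ≤ 0) (k : ℕ) :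
    a ⊓ k • p ≤ 0 := by
  have := inf_sum_le_zero ha (Finset.range k) (f := fun _ => p) (fun _ _ => hp)
    fun _ _ => by rwa [inf_comm]
  simpa using this

lemma abs_sum_le_sum_abs' {ι : Type*} (s : Finset ι) (f : ι → X) :
    |∑ i ∈ s, f i| ≤ ∑ i ∈ s, |f i| := by
  have : IsOrderedAddMonoid X :=
    ⟨fun _ _ h c => add_le_add_left h c, fun _ _ h c => add_le_add_right h c⟩
  classical
  induction s using Finset.induction_on with
  | empty => simp
  | insert i s hi ih =>
    rw [Finset.sum_insert hi, Finset.sum_insert hi]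
    exact (abs_add_le _ _).trans (add_le_add le_rfl ih)

lemma UoConv.locallyNull {ι : Type*} [Preorder ι] {x : ι → X} (h : UoConv x 0) :
    LocallyNull x := by
  intro w hw
  obtain ⟨A, -, -, hA, hA'⟩ := h w hw.le
  obtain ⟨b, hb, hwb⟩ : ∃ b ∈ A, ¬ w ≤ b := by
    by_contra! hcon
    exact hw.not_ge (hA.2 fun b hb => hcon b hb)
  have hb0 : 0 ≤ b := hA.1 hb
  refine ⟨(w - b)⁺, ?_, ?_, ?_⟩
  · refine lt_of_le_of_ne (posPart_nonneg _) fun h0 => hwb ?_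
    exact sub_nonpos.1 (posPart_eq_zero.1 h0.symm)
  · exact sup_le (sub_le_self _ hb0) hw.le
  · obtain ⟨α₀, hα₀⟩ := hA' b hb
    refine ⟨α₀, fun α hα => ?_⟩
    have hle : |x α| ⊓ w ≤ b := by
      have := hα₀ α hα
      simp only [sub_zero] at this
      rw [abs_of_nonneg (le_inf (abs_nonneg _) hw.le)] at this
      exact this
    have hp : (w - b)⁺ ≤ (w - |x α|)⁺ := by
      refine sup_le ?_ (posPart_nonneg _)
      refine (sub_le_sub_left hle w).trans ?_
      rw [sub_inf, sub_self]
      exact le_rfl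
    exact (inf_le_inf_right _ hp).trans (posPart_sub_inf_posPart_sub_le _ _)

variable [Module ℝ X] [PosSMulMono ℝ X]

lemma LocallyNull.uoConv {ι : Type*} [Preorder ι] [IsDirectedOrder ι] [Nonempty ι]
    (hArch : ∀ a b : X, (∀ n : ℕ, n • a ≤ b) → a ≤ 0)
    {x : ι → X} (h : LocallyNull x) : UoConv x 0 := by
  intro u hu
  refine ⟨{a | 0 ≤ a ∧ ∃ α₀, ∀ α, α₀ ≤ α → |x α| ⊓ u ≤ a}, ?_, ?_, ?_, ?_⟩
  · exact ⟨u, hu, Classical.arbitrary ι, fun _ _ => inf_le_right⟩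
  · rintro a ⟨ha, α, hα⟩ b ⟨hb, β, hβ⟩
    obtain ⟨γ, hγα, hγβ⟩ := exists_ge_ge α β
    exact ⟨a ⊓ b, ⟨le_inf ha hb, γ, fun δ hδ =>
      le_inf (hα δ (hγα.trans hδ)) (hβ δ (hγβ.trans hδ))⟩, inf_le_left, inf_le_right⟩
  · refine ⟨fun a ha => ha.1, fun w₀ hw₀ => ?_⟩
    by_contra hcon
    obtain ⟨v, hvpos, hvv⟩ := exists_pos_add_self
      (lt_of_le_of_ne (posPart_nonneg w₀) fun h0 => hcon (posPart_eq_zero.1 h0.symm))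
    have hv0 : 0 ≤ v := hvpos.le
    obtain ⟨p, hp, hpv, α₀, hα₀⟩ := h v hvpos
    have hstep (k : ℕ) : p ≤ ((u - v)⁺ - k • p)⁺ := by
      have hmem : w₀ ≤ v + ((u - v)⁺ - k • p)⁺ := by
        refine hw₀ ⟨add_nonneg hv0 (posPart_nonneg _), α₀, fun α hα => ?_⟩
        set t : X := (|x α| ⊓ u - v)⁺ with ht
        have ht0 : 0 ≤ t := posPart_nonneg _
        have hpt : p ⊓ t ≤ 0 :=
          (inf_le_inf_left _ (posPart_mono (sub_le_sub_right inf_le_left v))).trans (hα₀ α hα)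
        have htu : t ≤ (u - v)⁺ := posPart_mono (sub_le_sub_right inf_le_right v)
        have hsum : t + k • p ≤ (u - v)⁺ ⊔ k • p := by
          rw [← inf_add_sup t (k • p)]
          exact (add_le_of_nonpos_left (nsmul_inf_le_zero hp.le ht0 hpt k)).trans
            (sup_le_sup_right htu _)
        have htk : t ≤ ((u - v)⁺ - k • p)⁺ := by
          refine (le_sub_iff_add_le.2 hsum).trans ?_
          rw [sup_sub, sub_self]
          exact le_rfl
        exact sub_le_iff_le_add'.1 ((le_posPart _).trans htk)
      have hpos : w₀⁺ ≤ v + ((u - v)⁺ - k • p)⁺ :=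
        sup_le hmem (add_nonneg hv0 (posPart_nonneg _))
      rw [← hvv] at hpos
      exact hpv.trans (le_of_add_le_add_left hpos)
    have hbound (k : ℕ) : k • p ≤ (u - v)⁺ := by
      induction k with
      | zero => rw [zero_smul]; exact posPart_nonneg _
      | succ k ih =>
        have := hstep k
        rw [posPart_of_nonneg (sub_nonneg.2 ih)] at this
        rw [succ_nsmul']
        exact le_sub_iff_add_le.1 this
    exact hp.not_ge (hArch p _ hbound)
  · rintro a ⟨-, α₀, hα₀⟩
    refine ⟨α₀, fun α hα => ?_⟩
    simp only [sub_zero]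
    rw [abs_of_nonneg (le_inf (abs_nonneg _) hu)]
    exact hα₀ α hα

lemma abs_cesaro_le (x : ℕ → X) (n : ℕ) : |cesaro x n| ≤ cesaro (fun i => |x i|) n := by
  have hc : (0 : ℝ) ≤ ((n + 1 : ℝ))⁻¹ := by positivity
  have hs := abs_sum_le_sum_abs' (Finset.range (n + 1)) x
  unfold cesaro
  refine sup_le (smul_le_smul_of_nonneg_left ((le_abs_self _).trans hs) hc) ?_
  rw [← smul_neg]
  exact smul_le_smul_of_nonneg_left ((neg_le_abs _).trans hs) hc

/-- If `y i ≤ v` for `i ≥ N` on the band generated by `p`, then the Cesàro means of `y` are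
eventually at most `2 v` on the band generated by some `0 < q ≤ p`. -/
lemma exists_inf_posPart_cesaro_sub_le
    (hArch : ∀ a b : X, (∀ n : ℕ, n • a ≤ b) → a ≤ 0)
    {y : ℕ → X} (hy : ∀ i, 0 ≤ y i) {p v : X} (hp : 0 < p) (hpv : p ≤ v) {N : ℕ}
    (hN : ∀ i, N ≤ i → p ⊓ (y i - v)⁺ ≤ 0) :
    ∃ q : X, 0 < q ∧ q ≤ p ∧ ∃ M, ∀ n, M ≤ n → q ⊓ (cesaro y n - (v + v))⁺ ≤ 0 := by
  have : IsOrderedAddMonoid X :=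
    ⟨fun _ _ h c => add_le_add_left h c, fun _ _ h c => add_le_add_right h c⟩
  set s : X := ∑ i ∈ Finset.range N, y i with hs
  have hs0 : 0 ≤ s := Finset.sum_nonneg fun i _ => hy i
  obtain ⟨k, hk⟩ : ∃ k : ℕ, ¬ p ≤ ((k + 1 : ℝ))⁻¹ • s := by
    by_contra! hcon
    refine hp.not_ge (hArch p s fun n => ?_)
    cases n with
    | zero => rwa [zero_smul]
    | succ k =>
      have hk : ((k + 1 : ℕ) : ℝ) ≠ 0 := by positivity
      have := smul_le_smul_of_nonneg_left (hcon k) (Nat.cast_nonneg (α := ℝ) (k + 1))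
      rwa [smul_smul, ← Nat.cast_succ, mul_inv_cancel₀ hk, one_smul,
        Nat.cast_smul_eq_nsmul] at this
  set r : X := ((k + 1 : ℝ))⁻¹ • s with hr
  have hr0 : 0 ≤ r := smul_nonneg (by positivity) hs0
  have hqp : (p - r)⁺ ≤ p := sup_le (sub_le_self _ hr0) hp.le
  refine ⟨(p - r)⁺, lt_of_le_of_ne (posPart_nonneg _) fun h0 =>
    hk (sub_nonpos.1 (posPart_eq_zero.1 h0.symm)), hqp, max N k, fun n hn => ?_⟩
  have hNn : N ≤ n := (le_max_left _ _).trans hn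
  have hkn : k ≤ n := (le_max_right _ _).trans hn
  set T : X := ∑ i ∈ Finset.Ico N (n + 1), (y i - v)⁺ with hT
  have hT0 : 0 ≤ T := Finset.sum_nonneg fun i _ => posPart_nonneg _
  have hv0 : 0 ≤ v := hp.le.trans hpv
  have hsum : ∑ i ∈ Finset.range (n + 1), y i ≤ s + (T + (n + 1) • v) := by
    rw [← Finset.sum_range_add_sum_Ico _ (Nat.le_succ_of_le hNn)]
    refine add_le_add le_rfl ?_
    calc ∑ i ∈ Finset.Ico N (n + 1), y i
        ≤ ∑ i ∈ Finset.Ico N (n + 1), ((y i - v)⁺ + v) :=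
          Finset.sum_le_sum fun i _ => sub_le_iff_le_add.1 (le_posPart _)
      _ = T + (n + 1 - N) • v := by
          rw [Finset.sum_add_distrib, Finset.sum_const, Nat.card_Ico]
      _ ≤ T + (n + 1) • v :=
          add_le_add le_rfl (nsmul_le_nsmul_left hv0 (Nat.sub_le _ _))
  have hn0 : ((n + 1 : ℕ) : ℝ) ≠ 0 := by positivity
  have hc : (0 : ℝ) ≤ ((n + 1 : ℝ))⁻¹ := by positivity
  have hmono {a b : ℝ} (hab : a ≤ b) {z : X} (hz : 0 ≤ z) : a • z ≤ b • z := by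
    rw [← sub_nonneg, ← sub_smul]
    exact smul_nonneg (sub_nonneg.2 hab) hz
  have hces : cesaro y n ≤ r + (T + v) := by
    refine (smul_le_smul_of_nonneg_left hsum hc).trans ?_
    rw [smul_add, smul_add]
    refine add_le_add (hmono ?_ hs0) (add_le_add ?_ ?_)
    · gcongr
    · refine (hmono (b := 1) ?_ hT0).trans (one_smul ℝ T).le
      exact inv_le_one_of_one_le₀ (by linarith [Nat.cast_nonneg (α := ℝ) n])
    · rw [← Nat.cast_smul_eq_nsmul ℝ, smul_smul, ← Nat.cast_succ, inv_mul_cancel₀ hn0, one_smul]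
  have hpos : (cesaro y n - (v + v))⁺ ≤ (r - p)⁺ + T := by
    refine sup_le ?_ (add_nonneg (posPart_nonneg _) hT0)
    calc cesaro y n - (v + v) ≤ r + (T + v) - (v + v) := sub_le_sub_right hces _
      _ = (r - v) + T := by abel
      _ ≤ (r - p)⁺ + T :=
          add_le_add ((sub_le_sub_left hpv r).trans (le_posPart _)) le_rfl
  refine (inf_le_inf_left _ hpos).trans (inf_add_le_zero (posPart_nonneg _) (posPart_nonneg _)
    hT0 (posPart_sub_inf_posPart_sub_le _ _) ?_)
  exact inf_sum_le_zero (posPart_nonneg _) _ (fun i _ => posPart_nonneg _) fun i hi =>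
    (inf_le_inf_right _ hqp).trans (hN i (Finset.mem_Ico.1 hi).1)

lemma LocallyNull.cesaro (hArch : ∀ a b : X, (∀ n : ℕ, n • a ≤ b) → a ≤ 0)
    {x : ℕ → X} (h : LocallyNull x) : LocallyNull (cesaro x) := by
  intro w hw
  obtain ⟨v, hv, rfl⟩ := exists_pos_add_self hw
  obtain ⟨p, hp, hpv, N, hN⟩ := h v hv
  obtain ⟨q, hq, hqp, M, hM⟩ :=
    exists_inf_posPart_cesaro_sub_le hArch (fun i => abs_nonneg (x i)) hp hpv hN
  refine ⟨q, hq, (hqp.trans hpv).trans (le_add_of_nonneg_left hv.le), M, fun n hn => ?_⟩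
  exact (inf_le_inf_left _ (posPart_mono (sub_le_sub_right (abs_cesaro_le x n) _))).trans
    (hM n hn)

lemma LocallyNull.cesaro_sub_cesaro (hArch : ∀ a b : X, (∀ n : ℕ, n • a ≤ b) → a ≤ 0)
    {x : ℕ → X} (h : LocallyNull fun m : ℕ × ℕ => x m.1 - x m.2) :
    LocallyNull fun m : ℕ × ℕ => _root_.cesaro x m.1 - _root_.cesaro x m.2 := by
  intro w hw
  obtain ⟨w', hw', rfl⟩ := exists_pos_add_self hw
  obtain ⟨v, hv, rfl⟩ := exists_pos_add_self hw'
  obtain ⟨p, hp, hpv, ⟨N₁, N₂⟩, hN⟩ := h v hv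
  set c : X := x (max N₁ N₂)
  obtain ⟨q, hq, hqp, M, hM⟩ :=
    exists_inf_posPart_cesaro_sub_le hArch (N := N₁) (fun i => abs_nonneg (x i - c)) hp hpv
      fun i hi => hN (i, max N₁ N₂) ⟨hi, le_max_right _ _⟩
  have hbound (n : ℕ) (hn : M ≤ n) : q ⊓ (|_root_.cesaro x n - c| - (v + v))⁺ ≤ 0 := by
    rw [← cesaro_sub_const]
    exact (inf_le_inf_left _ (posPart_mono (sub_le_sub_right (abs_cesaro_le _ n) _))).trans
      (hM n hn)
  refine ⟨q, hq, (hqp.trans hpv).trans ((le_add_of_nonneg_left hv.le).trans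
    (le_add_of_nonneg_left hw'.le)), (M, M), fun m hm => ?_⟩
  refine le_trans (inf_le_inf_left _ ?_) (inf_add_le_zero hq.le (posPart_nonneg _)
    (posPart_nonneg _) (hbound m.1 hm.1) (hbound m.2 hm.2))
  refine sup_le ?_ (add_nonneg (posPart_nonneg _) (posPart_nonneg _))
  have habs : |_root_.cesaro x m.1 - _root_.cesaro x m.2|
      ≤ |_root_.cesaro x m.1 - c| + |_root_.cesaro x m.2 - c| := by
    rw [abs_sub_comm (_root_.cesaro x m.2) c]
    exact (congrArg _ (sub_add_sub_cancel _ c _)).ge.trans (abs_add_le _ _)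
  calc _ ≤ _ := sub_le_sub_right habs _
    _ = (|_root_.cesaro x m.1 - c| - (v + v)) + (|_root_.cesaro x m.2 - c| - (v + v)) := by abel
    _ ≤ _ := add_le_add (le_posPart _) (le_posPart _)

end Helpers

/-- In an Archimedean vector lattice, if a sequence is uo-null then so
are its Cesàro means; if it is uo-Cauchy then so are its Cesàro means. -/
theorem cesaro_uoConv_of_uoConv
    {X : Type u} [Lattice X] [AddCommGroup X] [Module ℝ X]
    [CovariantClass X X (· + ·) (· ≤ ·)] [PosSMulMono ℝ X]
    (hArch : ∀ a b : X, (∀ n : ℕ, n • a ≤ b) → a ≤ 0)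
    (x : ℕ → X) :
    (UoConv x 0 → UoConv (cesaro x) 0) ∧ (UoCauchy x → UoCauchy (cesaro x)) :=
  ⟨fun h => (h.locallyNull.cesaro hArch).uoConv hArch,
    fun h => (LocallyNull.cesaro_sub_cesaro hArch (UoConv.locallyNull h)).uoConv hArch⟩
end

section
/- Let X be an Archimedean vector lattice and Y a sublattice of X. Then Y is uo-closed in X if and only if Y is order closed in X; that is, Y contains the uo-limit in X of every net of elements of Y that uo-converges in X if and only if Y contains the order limit in X of every net of elements of Y that order converges in X. -/
open Filter Finset

universe u v

section Helpers

variable {X : Type u} [Lattice X] [AddCommGroup X]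

/-- A net whose distance to `m` is dominated by an order null net order converges to `m`. -/
theorem OConv.of_abs_sub_le {ι : Type*} [Preorder ι] {f g : ι → X} {m : X}
    (hg : OConv g 0) (hfg : ∀ α, |f α - m| ≤ |g α|) : OConv f m := by
  obtain ⟨A, hne, hdir, hglb, hA⟩ := hg
  refine ⟨A, hne, hdir, hglb, fun a ha => ?_⟩
  obtain ⟨α₀, hα₀⟩ := hA a ha
  refine ⟨α₀, fun α hα => (hfg α).trans ?_⟩
  simpa using hα₀ α hα

theorem UoConv.neg {ι : Type*} [Preorder ι] {f : ι → X} {l : X} (h : UoConv f l) :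
    UoConv (fun α => -f α) (-l) := by
  intro u hu
  have e : ∀ α, |-f α - -l| = |f α - l| := fun α => by
    rw [neg_sub_neg, abs_sub_comm]
  simpa only [e] using h u hu

variable [AddLeftMono X]

theorem OConv.uoConv {ι : Type*} [Preorder ι] {f : ι → X} {l : X} (h : OConv f l) :
    UoConv f l := by
  intro u hu
  obtain ⟨A, hne, hdir, hglb, hA⟩ := h
  refine ⟨A, hne, hdir, hglb, fun a ha => ?_⟩
  obtain ⟨α₀, hα₀⟩ := hA a ha
  refine ⟨α₀, fun α hα => ?_⟩
  rw [sub_zero, abs_of_nonneg (le_inf (abs_nonneg _) hu)]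
  exact inf_le_left.trans (hα₀ α hα)

theorem UoConv.posPart {ι : Type*} [Preorder ι] {f : ι → X} {l : X} (h : UoConv f l) :
    UoConv (fun α => f α ⊔ 0) (l ⊔ 0) := by
  intro u hu
  refine (h u hu).of_abs_sub_le fun α => ?_
  rw [sub_zero, abs_of_nonneg (le_inf (abs_nonneg _) hu),
    abs_of_nonneg (le_inf (abs_nonneg _) hu)]
  exact inf_le_inf_right _ (abs_sup_sub_sup_le_abs _ _ _)

theorem abs_inf_sub_inf_le_abs_inf {a b c : X} (ha : 0 ≤ a) (hb : 0 ≤ b) (hc : 0 ≤ c) :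
    |a ⊓ c - b ⊓ c| ≤ |a - b| ⊓ c := by
  refine le_inf (abs_inf_sub_inf_le_abs _ _ _) (abs_le'.2 ⟨?_, ?_⟩)
  · exact (sub_le_self _ (le_inf hb hc)).trans inf_le_right
  · rw [neg_sub]
    exact (sub_le_self _ (le_inf ha hc)).trans inf_le_right

/-- Truncations of a positive uo-convergent net order converge. -/
theorem UoConv.oConv_inf {ι : Type*} [Preorder ι] {f : ι → X} {l : X} (h : UoConv f l)
    (hf : ∀ α, 0 ≤ f α) (hl : 0 ≤ l) {w : X} (hw : 0 ≤ w) :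
    OConv (fun α => f α ⊓ w) (l ⊓ w) :=
  (h w hw).of_abs_sub_le fun α =>
    (abs_inf_sub_inf_le_abs_inf (hf α) hl hw).trans (le_abs_self _)

/-- If `z` can be subtracted from `l` below every truncation of `l` by a multiple of `w`,
then `z` is disjoint from `w`. -/
theorem inf_le_zero_of_forall_inf_nsmul_le
    (hArch : ∀ a b : X, (∀ n : ℕ, n • a ≤ b) → a ≤ 0) {l z w : X} (hl : 0 ≤ l)
    (h : ∀ n : ℕ, l ⊓ n • w ≤ l - z) : z ⊓ w ≤ 0 := by
  refine hArch _ l fun n => ?_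
  have key : ∀ n : ℕ, n • (z ⊓ w) ≤ l ⊓ n • w := by
    intro n
    induction n with
    | zero => simpa using hl
    | succ n ih =>
      rw [succ_nsmul, succ_nsmul]
      refine le_inf ?_ (add_le_add (ih.trans inf_le_right) inf_le_right)
      calc n • (z ⊓ w) + z ⊓ w ≤ (l - z) + z := add_le_add (ih.trans (h n)) inf_le_left
        _ = l := sub_add_cancel _ _
  exact (key n).trans inf_le_left

theorem OConv.eq_zero_of_forall_eq {ι : Type*} [Preorder ι]
    (hd : ∀ a b : ι, ∃ c, a ≤ c ∧ b ≤ c) {f : ι → X} {m : X} (h : OConv f m)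
    (hf : ∀ α, f α = 0) (hm : 0 ≤ m) : m = 0 := by
  obtain ⟨A, -, -, hglb, hA⟩ := h
  refine le_antisymm (hglb.2 fun a ha => ?_) hm
  obtain ⟨α₀, hα₀⟩ := hA a ha
  obtain ⟨c, hc, -⟩ := hd α₀ α₀
  have := hα₀ c hc
  rwa [hf, zero_sub, abs_neg, abs_of_nonneg hm] at this

/-- An order closed additive sublattice contains the uo-limits of its positive nets. -/
theorem mem_of_uoConv_of_nonneg
    (hArch : ∀ a b : X, (∀ n : ℕ, n • a ≤ b) → a ≤ 0)
    (Y : Set X) (hY0 : (0 : X) ∈ Y)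
    (hYadd : ∀ a ∈ Y, ∀ b ∈ Y, a + b ∈ Y)
    (hYsup : ∀ a ∈ Y, ∀ b ∈ Y, a ⊔ b ∈ Y)
    (hYinf : ∀ a ∈ Y, ∀ b ∈ Y, a ⊓ b ∈ Y)
    (hcl : ∀ (ι : Type u) (pι : Preorder ι), Nonempty ι →
        (∀ a b : ι, ∃ c : ι, pι.le a c ∧ pι.le b c) →
        ∀ f : ι → X, (∀ α, f α ∈ Y) → ∀ l : X, @OConv X _ _ ι pι f l → l ∈ Y)
    {ι : Type u} [pι : Preorder ι] [hne : Nonempty ι] (hd : ∀ a b : ι, ∃ c, a ≤ c ∧ b ≤ c)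
    {f : ι → X} (hfY : ∀ α, f α ∈ Y) (hf : ∀ α, 0 ≤ f α) {l : X} (hl : 0 ≤ l)
    (h : UoConv f l) : l ∈ Y := by
  have htrunc : ∀ w ∈ Y, 0 ≤ w → l ⊓ w ∈ Y := fun w hwY hw =>
    hcl ι pι hne hd _ (fun α => hYinf _ (hfY α) _ hwY) _ (h.oConv_inf hf hl hw)
  have hnsmul : ∀ w ∈ Y, ∀ n : ℕ, n • w ∈ Y := by
    intro w hw n
    induction n with
    | zero => simpa using hY0
    | succ n ih => rw [succ_nsmul]; exact hYadd _ ih _ hw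
  have hsup : ∀ a b : {w : X // w ∈ Y ∧ 0 ≤ w}, ∃ c : {w : X // w ∈ Y ∧ 0 ≤ w},
      a ≤ c ∧ b ≤ c := fun a b =>
    ⟨⟨a.1 ⊔ b.1, hYsup _ a.2.1 _ b.2.1, a.2.2.trans le_sup_left⟩, le_sup_left (a := a.1),
      le_sup_right (a := a.1)⟩
  refine hcl {w : X // w ∈ Y ∧ 0 ≤ w} inferInstance ⟨⟨0, hY0, le_rfl⟩⟩ hsup
    (fun w => l ⊓ w.1) (fun w => htrunc w.1 w.2.1 w.2.2) l ?_
  refine ⟨Set.range fun w : {w : X // w ∈ Y ∧ 0 ≤ w} => l - l ⊓ w.1,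
    ⟨_, ⟨0, hY0, le_rfl⟩, rfl⟩, ?_, ⟨?_, fun v hv => ?_⟩, ?_⟩
  · rintro _ ⟨a, rfl⟩ _ ⟨b, rfl⟩
    obtain ⟨c, hac, hbc⟩ := hsup a b
    exact ⟨_, ⟨c, rfl⟩, sub_le_sub_left (inf_le_inf_left _ hac) _,
      sub_le_sub_left (inf_le_inf_left _ hbc) _⟩
  · rintro _ ⟨w, rfl⟩
    exact sub_nonneg.2 inf_le_left
  · have hz : ∀ w ∈ Y, 0 ≤ w → v ⊔ 0 ≤ l - l ⊓ w := fun w hwY hw =>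
      sup_le (hv ⟨⟨w, hwY, hw⟩, rfl⟩) (sub_nonneg.2 inf_le_left)
    have hzl : v ⊔ 0 ≤ l := by simpa [hl] using hz 0 hY0 le_rfl
    have hdisj : ∀ α, f α ⊓ (v ⊔ 0) = 0 := fun α => by
      refine le_antisymm ?_ (le_inf (hf α) le_sup_right)
      rw [inf_comm]
      exact inf_le_zero_of_forall_inf_nsmul_le hArch hl fun n =>
        le_sub_comm.1 (hz _ (hnsmul _ (hfY α) n) (nsmul_nonneg (hf α) n))
    have hlz := (h.oConv_inf hf hl (le_sup_right (a := v))).eq_zero_of_forall_eq hd hdisj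
      (le_inf hl le_sup_right)
    rw [inf_eq_right.2 hzl] at hlz
    exact le_sup_left.trans hlz.le
  · rintro _ ⟨w, rfl⟩
    refine ⟨w, fun w' hw' => ?_⟩
    rw [abs_sub_comm, abs_of_nonneg (sub_nonneg.2 inf_le_left)]
    exact sub_le_sub_left (inf_le_inf_left _ hw') _

end Helpers

/-- A sublattice `Y` of an Archimedean vector lattice `X` is uo-closed in
`X` iff it is order closed in `X`. -/
theorem uoClosed_iff_oClosed
    {X : Type u} [Lattice X] [AddCommGroup X] [Module ℝ X]
    [CovariantClass X X (· + ·) (· ≤ ·)] [PosSMulMono ℝ X]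
    (hArch : ∀ a b : X, (∀ n : ℕ, n • a ≤ b) → a ≤ 0)
    (Y : Set X) (hY0 : (0 : X) ∈ Y)
    (hYadd : ∀ a ∈ Y, ∀ b ∈ Y, a + b ∈ Y)
    (hYsmul : ∀ (c : ℝ), ∀ a ∈ Y, c • a ∈ Y)
    (hYsup : ∀ a ∈ Y, ∀ b ∈ Y, a ⊔ b ∈ Y)
    (hYinf : ∀ a ∈ Y, ∀ b ∈ Y, a ⊓ b ∈ Y) :
    (∀ (ι : Type u) (pι : Preorder ι), Nonempty ι →
        (∀ a b : ι, ∃ c : ι, pι.le a c ∧ pι.le b c) →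
        ∀ f : ι → X, (∀ α, f α ∈ Y) → ∀ l : X, @UoConv X _ _ ι pι f l → l ∈ Y) ↔
    (∀ (ι : Type u) (pι : Preorder ι), Nonempty ι →
        (∀ a b : ι, ∃ c : ι, pι.le a c ∧ pι.le b c) →
        ∀ f : ι → X, (∀ α, f α ∈ Y) → ∀ l : X, @OConv X _ _ ι pι f l → l ∈ Y) := by
  constructor
  · intro H ι pι hne hd f hf l hl
    exact H ι pι hne hd f hf l hl.uoConv
  · intro H ι pι hne hd f hf l hl
    have hneg : ∀ a ∈ Y, -a ∈ Y := fun a ha => by simpa using hYsmul (-1) a ha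
    have hpos : l ⊔ 0 ∈ Y :=
      mem_of_uoConv_of_nonneg hArch Y hY0 hYadd hYsup hYinf H hd
        (fun α => hYsup _ (hf α) _ hY0) (fun _ => le_sup_right) le_sup_right hl.posPart
    have hnegPart : -l ⊔ 0 ∈ Y :=
      mem_of_uoConv_of_nonneg hArch Y hY0 hYadd hYsup hYinf H hd
        (fun α => hYsup _ (hneg _ (hf α)) _ hY0) (fun _ => le_sup_right) le_sup_right
        hl.neg.posPart
    have hsub : l ⊔ 0 + -(-l ⊔ 0) = l := by
      rw [← sub_eq_add_neg]
      exact posPart_sub_negPart l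
    exact hsub ▸ hYadd _ hpos _ (hneg _ hnegPart)
end
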